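/- arXiv:1206.5728 — 2 statements merged into one kernel-verified Lean document; each statement's English description precedes it below -/
import Mathlib

section
/- For every integer n ≥ 5, the abelianization H₁(C(ρ)) of the centralizer of the Nielsen automorphism ρ in Aut(F_n) is isomorphic to (ℤ/2ℤ)². -/
namespace FreeGroup

variable {X : Type*} [DecidableEq X]

/-- The length of the longest common initial segment of two lists. -/
def commonPrefixLength {β : Type*} [DecidableEq β] : List β → List β → ℕ
  | x :: l, y :: m => if x = y then commonPrefixLength l m + 1 else 0
  | _, _ => 0

theorem le_commonPrefixLength {β : Type*} [DecidableEq β] {k : ℕ} {l m : List β} :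
    k ≤ commonPrefixLength l m ↔ l.take k = m.take k ∧ k ≤ l.length ∧ k ≤ m.length := by
  induction l generalizing m k with
  | nil => cases k <;> simp [commonPrefixLength]
  | cons x l ih =>
    cases m with
    | nil => cases k <;> simp [commonPrefixLength]
    | cons y m =>
      cases k with
      | zero => simp
      | succ k =>
        by_cases h : x = y
        · simp [commonPrefixLength, h, ih]
        · simp [commonPrefixLength, h]

/-- The Gromov product of `g` and `h` based at the identity vertex of the Cayley tree:
the length of the longest common initial segment of the reduced words of `g` and `h`. -/
def gromov (g h : FreeGroup X) : ℕ := commonPrefixLength g.toWord h.toWord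

theorem le_gromov {k : ℕ} {g h : FreeGroup X} :
    k ≤ gromov g h ↔ g.toWord.take k = h.toWord.take k ∧ k ≤ g.norm ∧ k ≤ h.norm :=
  le_commonPrefixLength

theorem gromov_comm (g h : FreeGroup X) : gromov g h = gromov h g :=
  eq_of_forall_le_iff fun k => by rw [le_gromov, le_gromov]; tauto

theorem gromov_le_left (g h : FreeGroup X) : gromov g h ≤ g.norm :=
  (le_gromov.1 le_rfl).2.1

theorem gromov_le_right (g h : FreeGroup X) : gromov g h ≤ h.norm :=
  (le_gromov.1 le_rfl).2.2

theorem min_gromov_le (g h k : FreeGroup X) : min (gromov g h) (gromov h k) ≤ gromov g k := by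
  obtain ⟨h₁, h₂, -⟩ := le_gromov.1 (min_le_left (gromov g h) (gromov h k))
  obtain ⟨h₃, -, h₄⟩ := le_gromov.1 (min_le_right (gromov g h) (gromov h k))
  exact le_gromov.2 ⟨h₁.trans h₃, h₂, h₄⟩

theorem norm_mk_of_isReduced {l : List (X × Bool)} (h : IsReduced l) : (mk l).norm = l.length := by
  rw [norm, toWord_mk, h.reduce_eq]

theorem norm_inv_mul_mk (l m : List (X × Bool)) (hl : IsReduced l) (hm : IsReduced m) :
    ((mk l)⁻¹ * mk m).norm + 2 * commonPrefixLength l m = l.length + m.length := by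
  induction l generalizing m with
  | nil => simp [commonPrefixLength, norm_mk_of_isReduced hm, ← one_eq_mk]
  | cons x l ih =>
    cases m with
    | nil =>
      simp only [commonPrefixLength, ← one_eq_mk, mul_one, norm_inv_eq, norm_mk_of_isReduced hl]
      simp
    | cons y m =>
      by_cases h : x = y
      · subst h
        have := ih m (List.IsChain.tail hl) (List.IsChain.tail hm)
        have e : (mk (x :: l))⁻¹ * mk (x :: m) = (mk l)⁻¹ * mk m := by
          rw [← List.singleton_append, ← mul_mk, ← List.singleton_append (l := m), ← mul_mk]
          group
        rw [e]
        simp only [commonPrefixLength, if_true, List.length_cons]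
        omega
      · have hr : IsReduced (invRev (x :: l) ++ y :: m) := by
          have h₁ : IsReduced (invRev (x :: l)) := by
            rw [isReduced_iff_reduce_eq, reduce_invRev, hl.reduce_eq]
          unfold IsReduced at *
          rw [List.isChain_append]
          refine ⟨h₁, hm, ?_⟩
          obtain ⟨x, b⟩ := x
          obtain ⟨y, c⟩ := y
          cases b <;> cases c <;> simp_all [invRev]
        rw [inv_mk, mul_mk, norm_mk_of_isReduced hr]
        simp [commonPrefixLength, h]

theorem norm_inv_mul (g h : FreeGroup X) :
    (g⁻¹ * h).norm + 2 * gromov g h = g.norm + h.norm := by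
  have := norm_inv_mul_mk g.toWord h.toWord isReduced_toWord isReduced_toWord
  rwa [mk_toWord, mk_toWord] at this

theorem norm_lt_norm_mul_self {g : FreeGroup X} (hg : g ≠ 1) : g.norm < (g * g).norm := by
  have h := reduceCyclically.reduce_flatten_replicate_succ (isReduced_toWord (x := g))
  have h0 := congrArg List.length (h 0)
  have h1 := congrArg List.length (h 1)
  have e : g * g = mk (g.toWord ++ g.toWord) := by rw [← mul_mk, mk_toWord]
  rw [e, norm, norm, toWord_mk]
  simp [List.replicate_succ] at h0 h1
  have h2 : (reduceCyclically g.toWord).length ≠ 0 := by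
    intro h2
    have := reduceCyclically.conj_conjugator_reduceCyclically g.toWord
    rw [List.length_eq_zero_iff.1 h2] at this
    apply hg
    rw [← mk_toWord (x := g), ← this, List.append_nil, ← mul_mk, ← inv_mk,
      mul_inv_cancel]
  omega

end FreeGroup

namespace FreeGroup

variable {X : Type*} [DecidableEq X]

theorem toWord_mk_of_norm_eq {l : List (X × Bool)} (h : (mk l).norm = l.length) :
    (mk l).toWord = l := by
  rw [toWord_mk]
  refine (reduce.red (L := l)).sublist.eq_of_length ?_
  rwa [norm, toWord_mk] at h

theorem toWord_conj_of_norm_eq {w : FreeGroup X} {e : X × Bool}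
    (h : (w * mk [e] * w⁻¹).norm = 2 * w.norm + 1) :
    (w * mk [e] * w⁻¹).toWord = w.toWord ++ e :: invRev w.toWord := by
  have e₁ : w * mk [e] * w⁻¹ = mk (w.toWord ++ e :: invRev w.toWord) := by
    conv_lhs => rw [← mk_toWord (x := w)]
    rw [inv_mk, mul_mk, mul_mk]
    simp
  rw [e₁] at h ⊢
  apply toWord_mk_of_norm_eq
  rw [h]
  simp [norm]
  omega

theorem norm_conj_le (w : FreeGroup X) (e : X × Bool) :
    (w * mk [e] * w⁻¹).norm ≤ 2 * w.norm + 1 := by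
  have h₁ := norm_mul_le (w * mk [e]) w⁻¹
  have h₂ := norm_mul_le w (mk [e])
  have h₃ : (mk [e]).norm ≤ 1 := norm_mk_le
  rw [norm_inv_eq] at h₁
  omega

section Cost

variable [Fintype X]

/-- The value of a word read as a sequence of digits, most significant digit first. -/
noncomputable def weight (l : List (X × Bool)) : ℕ :=
  Nat.ofDigits (Fintype.card (X × Bool) + 2)
    (l.reverse.map fun e => (Fintype.equivFin (X × Bool) e : ℕ))

omit [DecidableEq X] in
theorem weight_append (l m : List (X × Bool)) :
    weight (l ++ m) = weight m + (Fintype.card (X × Bool) + 2) ^ m.length * weight l := by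
  simp [weight, Nat.ofDigits_append]

omit [DecidableEq X] in
theorem weight_append_lt {l l' : List (X × Bool)} (h : weight l < weight l')
    (m : List (X × Bool)) : weight (l ++ m) < weight (l' ++ m) := by
  rw [weight_append, weight_append]
  gcongr

omit [DecidableEq X] in
theorem eq_of_weight_eq {l m : List (X × Bool)} (hlen : l.length = m.length)
    (h : weight l = weight m) : l = m := by
  have := Nat.ofDigits_inj_of_len_eq (b := Fintype.card (X × Bool) + 2) (by omega)
    (by simpa using hlen) (L1 := l.reverse.map fun e => (Fintype.equivFin (X × Bool) e : ℕ))
    (L2 := m.reverse.map fun e => (Fintype.equivFin (X × Bool) e : ℕ)) ?_ ?_ h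
  · rw [List.map_inj_right (fun a b hab => by simpa [Fin.val_inj] using hab)] at this
    exact List.reverse_injective this
  all_goals
    intro x hx
    rw [List.mem_map] at hx
    obtain ⟨e, -, rfl⟩ := hx
    omega

/-- The weight of the initial half of a reduced word. -/
noncomputable def halfWeight (g : FreeGroup X) : ℕ := weight (g.toWord.take (g.norm / 2))

/-- The complexity of an element: its length, with ties broken by the weights of its halves. -/
noncomputable def cost (g : FreeGroup X) : ℕ ×ₗ ℕ :=
  toLex (g.norm, halfWeight g + halfWeight g⁻¹)

theorem cost_inv (g : FreeGroup X) : cost g⁻¹ = cost g := by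
  simp only [cost, norm_inv_eq, inv_inv, add_comm]

theorem cost_lt_of_norm_lt {g h : FreeGroup X} (hn : g.norm < h.norm) : cost g < cost h :=
  Prod.Lex.toLex_lt_toLex.2 (Or.inl hn)

theorem norm_le_of_cost_le {g h : FreeGroup X} (hn : cost g ≤ cost h) : g.norm ≤ h.norm :=
  not_lt.1 fun h' => not_lt.2 hn (cost_lt_of_norm_lt h')

omit [Fintype X] in
theorem length_take_inv {d : FreeGroup X} {k : ℕ} (hd : d.norm = 2 * k) :
    (d⁻¹.toWord.take k).length = k := by
  have : d⁻¹.toWord.length = 2 * k := by rw [← hd, ← norm_inv_eq]; rfl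
  rw [List.length_take]
  omega

omit [Fintype X] in
theorem eq_mk_take_mul {d : FreeGroup X} {k : ℕ} (hd : d.norm = 2 * k) :
    d = mk (d.toWord.take k) * (mk (d⁻¹.toWord.take k))⁻¹ := by
  have h : invRev (d⁻¹.toWord.take k) = d.toWord.drop k := by
    have hl : d.toWord.length = 2 * k := hd
    rw [toWord_inv, invRev, invRev, List.take_reverse, List.map_reverse, List.reverse_reverse,
      List.map_drop, List.map_map]
    simp [hl, two_mul, Function.comp_def]
  rw [inv_mk, h, mul_mk, List.take_append_drop, mk_toWord]

omit [Fintype X] in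
theorem inv_mul_eq_mk {d v : FreeGroup X} {k : ℕ} (hd : d.norm = 2 * k)
    (hv : d.toWord.take k = v.toWord.take k) :
    d⁻¹ * v = mk (d⁻¹.toWord.take k ++ v.toWord.drop k) := by
  have h : v = mk (d.toWord.take k) * mk (v.toWord.drop k) := by
    rw [hv, mul_mk, List.take_append_drop, mk_toWord]
  conv_lhs => rw [h]
  conv_lhs => enter [1]; rw [eq_mk_take_mul hd]
  rw [← mul_mk]
  group

theorem cost_inv_mul_lt {d v : FreeGroup X} {k : ℕ} (hd : d.norm = 2 * k)
    (hv : d.toWord.take k = v.toWord.take k) (hk : 2 * k ≤ v.norm)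
    (hw : weight (d⁻¹.toWord.take k) < weight (d.toWord.take k)) :
    cost (d⁻¹ * v) < cost v := by
  have hlen : (d⁻¹.toWord.take k ++ v.toWord.drop k).length = v.norm := by
    rw [List.length_append, length_take_inv hd, List.length_drop]
    unfold norm at hk ⊢
    omega
  have hle : (d⁻¹ * v).norm ≤ v.norm := by
    rw [inv_mul_eq_mk hd hv, ← hlen]
    exact norm_mk_le
  rcases hle.lt_or_eq with h | h
  · exact cost_lt_of_norm_lt h
  have hword : (d⁻¹ * v).toWord = d⁻¹.toWord.take k ++ v.toWord.drop k := by
    rw [inv_mul_eq_mk hd hv] at h ⊢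
    exact toWord_mk_of_norm_eq (h.trans hlen.symm)
  refine Prod.Lex.toLex_lt_toLex.2 (Or.inr ⟨h, ?_⟩)
  have hdl := length_take_inv hd
  have hvl : (v.toWord.take k).length = k := by
    simp [norm] at hk ⊢
    omega
  have h₁ : halfWeight (d⁻¹ * v) < halfWeight v := by
    rw [halfWeight, halfWeight, h, hword]
    conv_rhs => rw [← List.take_append_drop k v.toWord]
    rw [List.take_append, List.take_append, hdl, hvl, List.take_of_length_le (by omega),
      List.take_of_length_le (l := v.toWord.take k) (by omega)]
    exact weight_append_lt (by rwa [← hv]) _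
  have h₂ : halfWeight (d⁻¹ * v)⁻¹ = halfWeight v⁻¹ := by
    rw [halfWeight, halfWeight, norm_inv_eq, norm_inv_eq, h, toWord_inv, toWord_inv, hword]
    conv_rhs => rw [← List.take_append_drop k v.toWord]
    have : v.norm / 2 ≤ (v.toWord.drop k).length := by
      simp [norm] at hk ⊢
      omega
    rw [invRev_append, invRev_append, List.take_append_of_le_length (by simpa using this),
      List.take_append_of_le_length (by simpa using this)]
  omega

theorem cost_conj_lt {d w : FreeGroup X} {e : X × Bool} {k : ℕ} (hd : d.norm = 2 * k)
    (hw : (w * mk [e] * w⁻¹).norm = 2 * w.norm + 1)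
    (hv : d.toWord.take k = w.toWord.take k) (hk : k ≤ w.norm)
    (hwt : weight (d⁻¹.toWord.take k) < weight (d.toWord.take k)) :
    cost (d⁻¹ * (w * mk [e] * w⁻¹) * d) < cost (w * mk [e] * w⁻¹) := by
  have heq : d⁻¹ * (w * mk [e] * w⁻¹) * d = (d⁻¹ * w) * mk [e] * (d⁻¹ * w)⁻¹ := by group
  rw [heq]
  have hlen : (d⁻¹.toWord.take k ++ w.toWord.drop k).length = w.norm := by
    rw [List.length_append, length_take_inv hd, List.length_drop]
    unfold norm at hk ⊢
    omega
  have hle : (d⁻¹ * w).norm ≤ w.norm := by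
    rw [inv_mul_eq_mk hd hv, ← hlen]
    exact norm_mk_le
  have hle' := norm_conj_le (d⁻¹ * w) e
  by_cases h : ((d⁻¹ * w) * mk [e] * (d⁻¹ * w)⁻¹).norm < (w * mk [e] * w⁻¹).norm
  · exact cost_lt_of_norm_lt h
  have hn : (d⁻¹ * w).norm = w.norm := by omega
  have hn' : ((d⁻¹ * w) * mk [e] * (d⁻¹ * w)⁻¹).norm = 2 * (d⁻¹ * w).norm + 1 := by omega
  have hword : (d⁻¹ * w).toWord = d⁻¹.toWord.take k ++ w.toWord.drop k := by
    rw [inv_mul_eq_mk hd hv] at hn ⊢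
    exact toWord_mk_of_norm_eq (hn.trans hlen.symm)
  have half : ∀ (z : FreeGroup X) (f : X × Bool), (z * mk [f] * z⁻¹).norm = 2 * z.norm + 1 →
      halfWeight (z * mk [f] * z⁻¹) = weight z.toWord := by
    intro z f hz
    rw [halfWeight, hz, toWord_conj_of_norm_eq hz, List.take_append_of_le_length (by simp [norm]; omega),
      List.take_of_length_le (by simp [norm]; omega)]
  have half' : ∀ (z : FreeGroup X) (f : X × Bool), (z * mk [f] * z⁻¹).norm = 2 * z.norm + 1 →
      halfWeight (z * mk [f] * z⁻¹)⁻¹ = weight z.toWord := by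
    intro z f hz
    have : (z * mk [f] * z⁻¹)⁻¹ = z * mk [(f.1, !f.2)] * z⁻¹ := by
      rw [show mk [(f.1, !f.2)] = (mk [f])⁻¹ by simp [invRev]]
      group
    rw [← norm_inv_eq, this] at hz
    rw [this, half _ _ hz]
  refine Prod.Lex.toLex_lt_toLex.2 (Or.inr ⟨by omega, ?_⟩)
  have key : weight (d⁻¹ * w).toWord < weight w.toWord := by
    rw [hword]
    conv_rhs => rw [← List.take_append_drop k w.toWord]
    exact weight_append_lt (by rwa [← hv]) _
  simp only [half _ _ hw, half' _ _ hw, half _ _ hn', half' _ _ hn']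
  omega

end Cost

end FreeGroup

namespace FreeGroup

variable {X : Type*} [DecidableEq X]

theorem norm_conj_of_getLast_ne {w : FreeGroup X} {e : X × Bool}
    (hlast : ∀ m l, w.toWord = m ++ [l] → l.1 ≠ e.1) :
    (w * mk [e] * w⁻¹).norm = 2 * w.norm + 1 := by
  have e₁ : w * mk [e] * w⁻¹ = mk (w.toWord ++ e :: invRev w.toWord) := by
    conv_lhs => rw [← mk_toWord (x := w)]
    rw [inv_mk, mul_mk, mul_mk]
    simp
  have hred : IsReduced (w.toWord ++ e :: invRev w.toWord) := by
    have h₁ : IsReduced w.toWord := isReduced_toWord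
    have h₂ : IsReduced (invRev w.toWord) := by rw [← toWord_inv]; exact isReduced_toWord
    rcases List.eq_nil_or_concat w.toWord with h | ⟨m, l, h⟩
    · simp [h, invRev]
    · rw [List.concat_eq_append] at h
      have h₃ := hlast m l h
      rw [h] at h₁ h₂ ⊢
      unfold IsReduced at *
      rw [List.isChain_append, List.isChain_cons]
      refine ⟨h₁, ⟨?_, h₂⟩, ?_⟩
      · simp [invRev]
        grind
      · simp
        grind
  rw [e₁, norm_mk_of_isReduced hred]
  simp [norm]
  omega

theorem exists_conj_norm_eq {e : X × Bool} {g : FreeGroup X} (h : IsConj (mk [e]) g) :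
    ∃ w : FreeGroup X, g = w * mk [e] * w⁻¹ ∧ (w * mk [e] * w⁻¹).norm = 2 * w.norm + 1 := by
  rw [isConj_iff] at h
  classical
  have hex : ∃ n : ℕ, ∃ w : FreeGroup X, w.norm = n ∧ w * mk [e] * w⁻¹ = g := by
    obtain ⟨w, hw⟩ := h
    exact ⟨_, w, rfl, hw⟩
  obtain ⟨w, hwn, hw⟩ := Nat.find_spec hex
  have hmin : ∀ z : FreeGroup X, z * mk [e] * z⁻¹ = g → w.norm ≤ z.norm := by
    intro z hz
    rw [hwn]
    exact Nat.find_min' hex ⟨z, rfl, hz⟩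
  refine ⟨w, hw.symm, norm_conj_of_getLast_ne ?_⟩
  intro m l hm hl
  have h₁ : w = mk m * mk [l] := by rw [mul_mk, ← hm, mk_toWord]
  have hcomm : mk [l] * mk [e] * (mk [l])⁻¹ = mk [e] := by
    obtain ⟨x, b⟩ := l
    obtain ⟨y, c⟩ := e
    obtain rfl : x = y := hl
    have : mk [(x, false)] = (mk [(x, true)])⁻¹ := by simp [invRev]
    cases b <;> cases c <;> (try simp only [this]) <;> group
  have h₂ : mk m * mk [e] * (mk m)⁻¹ = g := by
    rw [← hw, h₁]
    conv_lhs => rw [← hcomm]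
    group
  have h₃ := hmin _ h₂
  have h₄ : (mk m).norm ≤ m.length := norm_mk_le
  have h₅ : w.norm = m.length + 1 := by simp [norm, hm]
  omega

section Nielsen

variable [Fintype X] {v : X × Bool → FreeGroup X} {T : Set X}

theorem two_mul_gromov_le_of_cost_le {d g : FreeGroup X} (h : cost g ≤ cost (d⁻¹ * g)) :
    2 * gromov d g ≤ d.norm := by
  have h₁ := norm_inv_mul d g
  have h₂ := norm_le_of_cost_le h
  omega

theorem two_mul_gromov_le_of_cost_conj_le {d w : FreeGroup X} {e : X × Bool}
    (hw : (w * mk [e] * w⁻¹).norm = 2 * w.norm + 1)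
    (h : cost (w * mk [e] * w⁻¹) ≤ cost (d⁻¹ * (w * mk [e] * w⁻¹) * d)) :
    2 * gromov d w ≤ d.norm := by
  have h₁ := norm_inv_mul d w
  have h₂ := norm_le_of_cost_le h
  rw [show d⁻¹ * (w * mk [e] * w⁻¹) * d = (d⁻¹ * w) * mk [e] * (d⁻¹ * w)⁻¹ by group] at h₂
  have h₃ := norm_conj_le (d⁻¹ * w) e
  omega

omit [Fintype X] in
theorem gromov_conj {w : FreeGroup X} {e : X × Bool}
    (hw : (w * mk [e] * w⁻¹).norm = 2 * w.norm + 1) : gromov (w * mk [e] * w⁻¹) w = w.norm := by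
  refine le_antisymm (gromov_le_right _ _) (le_gromov.2 ⟨?_, by omega, le_rfl⟩)
  rw [toWord_conj_of_norm_eq hw, List.take_append_of_le_length (by simp [norm])]

/-- A family of elements indexed by signed letters, closed under inversion, whose members indexed by
`T` are conjugates of the corresponding letters, and whose complexity cannot be reduced by
conjugating a member in `T`, or multiplying a member outside `T`, by a member of another index. -/
structure IsCostMinimal (v : X × Bool → FreeGroup X) (T : Set X) : Prop where
  inv : ∀ e, v (e.1, !e.2) = (v e)⁻¹
  ne_one : ∀ e, v e ≠ 1
  isConj : ∀ e, e.1 ∈ T → IsConj (mk [e]) (v e)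
  cost_mul : ∀ d e, d.1 ≠ e.1 → e.1 ∉ T → cost (v e) ≤ cost ((v d)⁻¹ * v e)
  cost_conj : ∀ d e, d.1 ≠ e.1 → e.1 ∈ T → cost (v e) ≤ cost ((v d)⁻¹ * v e * v d)

namespace IsCostMinimal

theorem two_mul_gromov_self_inv_lt (hv : IsCostMinimal v T) (e : X × Bool) :
    2 * gromov (v e) (v e)⁻¹ < (v e).norm := by
  have h₁ := norm_inv_mul (v e) (v e)⁻¹
  have h₂ := norm_lt_norm_mul_self (inv_ne_one.2 (hv.ne_one e))
  rw [norm_inv_eq] at h₁ h₂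
  omega

theorem norm_lt_gromov (hv : IsCostMinimal v T) {d e : X × Bool} (hde : d.1 ≠ e.1)
    {w : FreeGroup X} (he : e.1 ∈ T) (hw : v e = w * FreeGroup.mk [e] * w⁻¹)
    (hwn : (w * FreeGroup.mk [e] * w⁻¹).norm = 2 * w.norm + 1)
    (h : (v d).norm < 2 * gromov (v d) (v e)) : w.norm < gromov (v d) (v e) := by
  have h₁ := hv.cost_conj d e hde he
  rw [hw] at h₁
  have h₂ := two_mul_gromov_le_of_cost_conj_le hwn h₁
  have h₃ := min_gromov_le (v d) (v e) w
  have h₄ := gromov_conj hwn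
  rw [← hw] at h₄
  omega

theorem norm_le_norm_conjugator (hv : IsCostMinimal v T) {d e : X × Bool} (hde : d.1 ≠ e.1)
    {w z : FreeGroup X} (he : e.1 ∈ T) (hw : v e = w * FreeGroup.mk [e] * w⁻¹)
    (hwn : (w * FreeGroup.mk [e] * w⁻¹).norm = 2 * w.norm + 1) (hz : v d = z * FreeGroup.mk [d] * z⁻¹)
    (hzn : (z * FreeGroup.mk [d] * z⁻¹).norm = 2 * z.norm + 1)
    (h : w.norm < gromov (v d) (v e)) : w.norm ≤ z.norm := by
  have h₁ := hv.cost_conj d e hde he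
  rw [hw] at h₁
  have h₂ := two_mul_gromov_le_of_cost_conj_le hwn h₁
  have h₃ := min_gromov_le (v d) (v e) w
  have h₄ := gromov_conj hwn
  rw [← hw] at h₄
  rw [← hz] at hzn
  omega

theorem two_mul_gromov_le (hv : IsCostMinimal v T) {d e : X × Bool} (hde : d ≠ e) :
    2 * gromov (v d) (v e) ≤ (v d).norm := by
  by_cases hi : d.1 = e.1
  · have : e = (d.1, !d.2) := by
      obtain ⟨x, b⟩ := d
      obtain ⟨y, c⟩ := e
      obtain rfl : x = y := hi
      cases b <;> cases c <;> simp_all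
    rw [this, hv.inv]
    exact (hv.two_mul_gromov_self_inv_lt d).le
  by_contra! hlt
  by_cases he : e.1 ∈ T
  swap
  · have := two_mul_gromov_le_of_cost_le (hv.cost_mul d e hi he)
    omega
  obtain ⟨w, hw, hwn⟩ := exists_conj_norm_eq (hv.isConj e he)
  have h₁ := hv.norm_lt_gromov hi he hw hwn hlt
  have h₂ : (v e).norm < 2 * gromov (v e) (v d) := by
    rw [gromov_comm, hw, hwn, ← hw]
    omega
  by_cases hd : d.1 ∈ T
  swap
  · have := two_mul_gromov_le_of_cost_le (hv.cost_mul e d (Ne.symm hi) hd)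
    omega
  obtain ⟨z, hz, hzn⟩ := exists_conj_norm_eq (hv.isConj d hd)
  have h₃ := hv.norm_lt_gromov (Ne.symm hi) hd hz hzn h₂
  have h₄ := hv.norm_le_norm_conjugator hi he hw hwn hz hzn h₁
  have h₅ := hv.norm_le_norm_conjugator (Ne.symm hi) hd hz hzn hw hwn h₃
  have h₆ : w.norm = z.norm := le_antisymm h₄ h₅
  have h₇ := (le_gromov.1 (Nat.succ_le_of_lt h₁)).1
  rw [hw, hz, toWord_conj_of_norm_eq hwn, toWord_conj_of_norm_eq hzn] at h₇
  have h₈ := congrArg (fun l => l[w.norm]?) h₇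
  have h₉ : w.toWord.length = w.norm := rfl
  have h₁₀ : z.toWord.length = w.norm := h₆.symm
  simp [h₉, h₁₀] at h₈
  exact hde h₈

theorem weight_le (hv : IsCostMinimal v T) {d e : X × Bool} (hde : d.1 ≠ e.1) {k : ℕ}
    (hd : (v d).norm = 2 * k) (hg : gromov (v d) (v e) = k) :
    weight ((v d).toWord.take k) ≤ weight ((v d)⁻¹.toWord.take k) := by
  by_contra! hlt
  have h₁ := hv.two_mul_gromov_le (fun h => hde (congrArg Prod.fst h.symm) : e ≠ d)
  rw [gromov_comm, hg] at h₁
  have h₂ := (le_gromov.1 hg.ge).1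
  by_cases he : e.1 ∈ T
  · obtain ⟨w, hw, hwn⟩ := exists_conj_norm_eq (hv.isConj e he)
    have hkw : k ≤ w.norm := by
      rw [hw] at h₁
      omega
    have := hv.cost_conj d e hde he
    rw [hw] at this
    refine not_lt.2 this (cost_conj_lt hd hwn ?_ hkw hlt)
    rw [h₂, hw, toWord_conj_of_norm_eq hwn, List.take_append_of_le_length hkw]
  · exact not_lt.2 (hv.cost_mul d e hde he) (cost_inv_mul_lt hd h₂ h₁ hlt)

theorem gromov_add_gromov_lt (hv : IsCostMinimal v T) {d e f : X × Bool} (hde : e ≠ d)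
    (hdf : f ≠ (d.1, !d.2)) : gromov (v d) (v e) + gromov (v d)⁻¹ (v f) < (v d).norm := by
  have h₁ := hv.two_mul_gromov_le hde.symm
  have h₂ := hv.two_mul_gromov_le hdf.symm
  rw [hv.inv, norm_inv_eq] at h₂
  by_contra! hge
  set k := gromov (v d) (v e) with hk
  have h₃ : (v d).norm = 2 * k := by omega
  have h₄ : gromov (v d)⁻¹ (v f) = k := by omega
  have h₅ := hv.two_mul_gromov_self_inv_lt d
  have hne : ∀ g : X × Bool, ∀ h, g.1 = h.1 → g ≠ h → v g = (v h)⁻¹ := by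
    rintro ⟨x, b⟩ ⟨y, c⟩ h h'
    obtain rfl : x = y := h
    have : b = !c := by cases b <;> cases c <;> simp_all
    rw [this]
    exact hv.inv (x, c)
  have hei : d.1 ≠ e.1 := by
    intro h
    rw [hne e d h.symm hde] at hk
    omega
  have hfi : d.1 ≠ f.1 := by
    intro h
    rw [hne f (d.1, !d.2) h.symm hdf, hv.inv, inv_inv, gromov_comm] at h₄
    omega
  have h₆ := hv.weight_le hei h₃ hk.symm
  have h₇ := hv.weight_le (d := (d.1, !d.2)) hfi (by rw [hv.inv, norm_inv_eq, h₃])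
    (by rw [hv.inv, h₄])
  rw [hv.inv, inv_inv] at h₇
  have h₈ : (v d).toWord.take k = (v d)⁻¹.toWord.take k := by
    refine eq_of_weight_eq ?_ (le_antisymm h₆ h₇)
    have h₉ := length_take_inv (d := (v d)⁻¹) (by rw [norm_inv_eq, h₃])
    rw [inv_inv] at h₉
    rw [length_take_inv h₃, h₉]
  have h₁₀ := le_gromov.2 ⟨h₈, by omega, by rw [norm_inv_eq]; omega⟩
  omega

theorem gromov_lt_and_length_le (hv : IsCostMinimal v T) (l : List (X × Bool)) (e : X × Bool)
    (h : IsReduced (e :: l)) :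
    (∀ f ≠ e, gromov (v f) (v e) < gromov (v e) ((e :: l).map v).prod) ∧
      l.length + gromov (v e) ((e :: l).map v).prod ≤ ((e :: l).map v).prod.norm := by
  induction l generalizing e with
  | nil =>
    have h₁ : gromov (v e) (v e) = (v e).norm :=
      le_antisymm (gromov_le_left _ _) (le_gromov.2 ⟨rfl, le_rfl, le_rfl⟩)
    simp only [List.map_cons, List.map_nil, List.prod_cons, List.prod_nil, mul_one, h₁]
    refine ⟨fun f hf => ?_, by simp⟩
    have := hv.two_mul_gromov_le hf.symm
    rw [gromov_comm]
    have := norm_eq_zero.not.2 (hv.ne_one e)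
    omega
  | cons e' l ih =>
    obtain ⟨ih₁, ih₂⟩ := ih e' (List.IsChain.tail h)
    rw [isReduced_cons_cons] at h
    set P := ((e' :: l).map v).prod with hP
    have hP' : ((e :: e' :: l).map v).prod = v e * P := by rw [List.map_cons, List.prod_cons]
    rw [hP']
    have hne : (e.1, !e.2) ≠ e' := by
      rintro rfl
      have := h.1 rfl
      simp at this
    have h₁ := ih₁ _ hne
    rw [hv.inv] at h₁
    have h₂ : gromov (v e)⁻¹ P = gromov (v e)⁻¹ (v e') := by
      have h₃ := min_gromov_le (v e)⁻¹ (v e') P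
      have h₄ := min_gromov_le (v e)⁻¹ P (v e')
      rw [gromov_comm P] at h₄
      omega
    have h₅ := norm_inv_mul (v e)⁻¹ P
    have h₆ := norm_inv_mul (v e) (v e * P)
    rw [inv_inv, norm_inv_eq] at h₅
    rw [inv_mul_cancel_left] at h₆
    refine ⟨fun f hf => ?_, ?_⟩
    · have h₇ := hv.gromov_add_gromov_lt hf hne.symm
      rw [gromov_comm (v e)] at h₇
      omega
    · simp only [List.length_cons]
      omega

theorem length_le_norm_prod (hv : IsCostMinimal v T) {l : List (X × Bool)} (h : IsReduced l) :
    l.length ≤ (l.map v).prod.norm := by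
  cases l with
  | nil => simp
  | cons e l =>
    obtain ⟨h₁, h₂⟩ := hv.gromov_lt_and_length_le l e h
    have := h₁ (e.1, !e.2) (fun h => by simpa using congrArg Prod.snd h)
    simp only [List.length_cons]
    omega

end IsCostMinimal

end Nielsen

end FreeGroup

namespace FreeGroup

variable {X : Type*} [DecidableEq X] [Fintype X]

omit [DecidableEq X] [Fintype X] in
theorem map_mk_singleton_not (α : MulAut (FreeGroup X)) (e : X × Bool) :
    α (mk [(e.1, !e.2)]) = (α (mk [e]))⁻¹ := by
  rw [← _root_.map_inv, inv_mk]
  simp [invRev]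

theorem exists_isCostMinimal {T : Set X} {S : Subgroup (MulAut (FreeGroup X))}
    (hconj : ∀ j ∈ T, ∀ d : X × Bool, d.1 ≠ j → ∃ σ ∈ S,
      σ (of j) = (mk [d])⁻¹ * of j * mk [d] ∧ ∀ k ≠ j, σ (of k) = of k)
    (hleft : ∀ j ∉ T, ∀ d : X × Bool, d.1 ≠ j → ∃ σ ∈ S,
      σ (of j) = (mk [d])⁻¹ * of j ∧ ∀ k ≠ j, σ (of k) = of k)
    (hright : ∀ j ∉ T, ∀ d : X × Bool, d.1 ≠ j → ∃ σ ∈ S,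
      σ (of j) = of j * mk [d] ∧ ∀ k ≠ j, σ (of k) = of k)
    {α : MulAut (FreeGroup X)} (hα : ∀ j ∈ T, IsConj (of j) (α (of j))) :
    ∃ σ ∈ S, IsCostMinimal (fun e => (α * σ) (mk [e])) T := by
  let P : MulAut (FreeGroup X) → Prop := fun σ => σ ∈ S ∧ ∀ j ∈ T, IsConj (of j) ((α * σ) (of j))
  let c : MulAut (FreeGroup X) → ℕ ×ₗ ℕ := fun σ => ∑ i, cost ((α * σ) (of i))
  obtain ⟨σ, ⟨hσ, hσT⟩, hmin⟩ : ∃ σ, P σ ∧ ∀ τ, P τ → c σ ≤ c τ := by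
    have hne : {σ | P σ}.Nonempty := ⟨1, S.one_mem, by simpa using hα⟩
    exact ⟨Function.argminOn c _ hne, Function.argminOn_mem c _ hne,
      fun τ hτ => Function.argminOn_le c _ hτ⟩
  have key : ∀ τ ∈ S, ∀ j, (∀ k ≠ j, τ (of k) = of k) →
      (j ∈ T → IsConj (of j) ((α * σ) (τ (of j)))) →
      cost ((α * σ) (of j)) ≤ cost ((α * σ) (τ (of j))) := by
    intro τ hτ j hk hj
    by_contra! hlt
    have hP : P (σ * τ) := by
      refine ⟨S.mul_mem hσ hτ, fun i hi => ?_⟩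
      by_cases hij : i = j
      · subst hij; exact hj hi
      · rw [← mul_assoc, MulAut.mul_apply, hk i hij]; exact hσT i hi
    refine (hmin _ hP).not_gt (Finset.sum_lt_sum (fun i _ => ?_) ⟨j, Finset.mem_univ _, hlt⟩)
    by_cases hij : i = j
    · subst hij; exact hlt.le
    · rw [← mul_assoc, MulAut.mul_apply, hk i hij]
  have hpos : ∀ j : X, mk [(j, true)] = of j := fun j => rfl
  refine ⟨σ, hσ, fun e => map_mk_singleton_not _ e, fun e h => ?_, ?_, ?_, ?_⟩
  · have : mk [e] = 1 := (map_eq_one_iff _ (α * σ).injective).1 h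
    have := congrArg norm this
    rw [norm_mk_of_isReduced (by simp)] at this
    simp at this
  · rintro ⟨j, b⟩ hj
    cases b
    · have := map_mk_singleton_not (α * σ) (j, true)
      simp only [Bool.not_true, hpos] at this
      rw [this]
      have h₁ : mk [(j, false)] = (of j)⁻¹ := rfl
      rw [h₁]
      obtain ⟨w, hw⟩ := isConj_iff.1 (hσT j hj)
      exact isConj_iff.2 ⟨w, by rw [← hw]; group⟩
    · exact hσT j hj
  · rintro d ⟨j, b⟩ hd hj
    cases b
    · have := map_mk_singleton_not (α * σ) (j, true)
      simp only [Bool.not_true, hpos] at this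
      simp only [this]
      obtain ⟨τ, hτ, hτj, hτk⟩ := hright j hj d hd
      have := key τ hτ j hτk (fun h => absurd h hj)
      rw [hτj, _root_.map_mul] at this
      rw [← mul_inv_rev, cost_inv, cost_inv]
      exact this
    · obtain ⟨τ, hτ, hτj, hτk⟩ := hleft j hj d hd
      have := key τ hτ j hτk (fun h => absurd h hj)
      rw [hτj, _root_.map_mul, _root_.map_inv] at this
      exact this
  · rintro d ⟨j, b⟩ hd hj
    obtain ⟨τ, hτ, hτj, hτk⟩ := hconj j hj d hd
    have := key τ hτ j hτk fun h => by
      rw [hτj, _root_.map_mul, _root_.map_mul, _root_.map_inv]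
      refine (hσT j h).trans (isConj_iff.2 ⟨((α * σ) (mk [d]))⁻¹, by group⟩)
    rw [hτj, _root_.map_mul, _root_.map_mul, _root_.map_inv] at this
    cases b
    · have h₁ := map_mk_singleton_not (α * σ) (j, true)
      simp only [Bool.not_true, hpos] at h₁
      simp only [h₁]
      rw [cost_inv, ← cost_inv (_ * _ * _)]
      simpa only [mul_inv_rev, inv_inv, mul_assoc] using this
    · exact this

theorem exists_apply_eq_of_of_isCostMinimal {T : Set X} {α : MulAut (FreeGroup X)}
    (h : IsCostMinimal (fun e => α (mk [e])) T) (i : X) : ∃ e : X × Bool, α (mk [e]) = of i := by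
  have h₁ := h.length_le_norm_prod (isReduced_toWord (x := α⁻¹ (of i)))
  have h₂ : ∀ l : List (X × Bool), (l.map fun e => α (mk [e])).prod = α (mk l) := by
    intro l
    induction l with
    | nil => simp [← one_eq_mk]
    | cons e l ih =>
      rw [List.map_cons, List.prod_cons, ih, ← _root_.map_mul, mul_mk]; rfl
  rw [h₂, mk_toWord, MulAut.apply_inv_self, norm_of] at h₁
  have h₃ : (α⁻¹ (of i)).toWord ≠ [] := by
    rw [Ne, toWord_eq_nil_iff, map_eq_one_iff _ (α⁻¹).injective]
    exact of_ne_one i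
  obtain ⟨e, he⟩ := List.length_eq_one_iff.1 (le_antisymm h₁ (List.length_pos_iff.2 h₃))
  refine ⟨e, ?_⟩
  rw [← he, mk_toWord, MulAut.apply_inv_self]

theorem exists_apply_of_eq_mk_of_isCostMinimal {T : Set X} {α : MulAut (FreeGroup X)}
    (h : IsCostMinimal (fun e => α (mk [e])) T) (i : X) : ∃ e : X × Bool, α (of i) = mk [e] := by
  choose f hf using exists_apply_eq_of_of_isCostMinimal h
  have hinj : Function.Injective fun i => (f i).1 := by
    intro i j hij
    have h₁ : f i = f j ∨ f i = ((f j).1, !(f j).2) := by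
      simp only at hij
      rcases hfi : f i with ⟨x, b⟩
      rcases hfj : f j with ⟨y, c⟩
      rw [hfi, hfj] at hij
      obtain rfl : x = y := hij
      cases b <;> cases c <;> simp
    rcases h₁ with h₁ | h₁
    · have := (hf i).symm.trans ((congrArg (fun e => α (mk [e])) h₁).trans (hf j))
      exact of_injective this
    · have := (hf i).symm.trans ((congrArg (fun e => α (mk [e])) h₁).trans
        (map_mk_singleton_not α (f j)))
      rw [hf j] at this
      have h₂ := congrArg (fun g => toWord g) this
      simp [toWord_inv, invRev] at h₂
  obtain ⟨k, hk⟩ := (Finite.injective_iff_surjective.1 hinj) i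
  simp only at hk
  rcases hfk : f k with ⟨x, b⟩
  have h₁ := hf k
  rw [hfk] at hk h₁
  obtain rfl : x = i := hk
  cases b
  · refine ⟨(k, false), ?_⟩
    have h₂ := map_mk_singleton_not α (x, true)
    simp only [Bool.not_true, h₁] at h₂
    have h₃ : α (of x) = (of k)⁻¹ := by rw [h₂, inv_inv]; rfl
    rw [h₃]; rfl
  · exact ⟨(k, true), h₁⟩

/-- Automorphisms of a free group sending each letter of `T` to a conjugate are generated by
partial conjugations of the letters in `T`, transvections of the other letters, and signed
permutations. -/
theorem mem_of_isConj {T : Set X} {S : Subgroup (MulAut (FreeGroup X))}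
    (hconj : ∀ j ∈ T, ∀ d : X × Bool, d.1 ≠ j → ∃ σ ∈ S,
      σ (of j) = (mk [d])⁻¹ * of j * mk [d] ∧ ∀ k ≠ j, σ (of k) = of k)
    (hleft : ∀ j ∉ T, ∀ d : X × Bool, d.1 ≠ j → ∃ σ ∈ S,
      σ (of j) = (mk [d])⁻¹ * of j ∧ ∀ k ≠ j, σ (of k) = of k)
    (hright : ∀ j ∉ T, ∀ d : X × Bool, d.1 ≠ j → ∃ σ ∈ S,
      σ (of j) = of j * mk [d] ∧ ∀ k ≠ j, σ (of k) = of k)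
    (hperm : ∀ α : MulAut (FreeGroup X), (∀ j ∈ T, α (of j) = of j) →
      (∀ i, ∃ e : X × Bool, α (of i) = mk [e]) → α ∈ S)
    {α : MulAut (FreeGroup X)} (hα : ∀ j ∈ T, IsConj (of j) (α (of j))) : α ∈ S := by
  obtain ⟨σ, hσ, h⟩ := exists_isCostMinimal hconj hleft hright hα
  suffices α * σ ∈ S by simpa using S.mul_mem this (S.inv_mem hσ)
  refine hperm _ (fun j hj => ?_) (exists_apply_of_eq_mk_of_isCostMinimal h)
  obtain ⟨e, he⟩ := exists_apply_of_eq_mk_of_isCostMinimal h j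
  have hc : IsConj (of j) ((α * σ) (of j)) := h.isConj (j, true) hj
  rw [he] at hc ⊢
  obtain ⟨w, hw⟩ := isConj_iff.1 hc
  let f : FreeGroup X →* Multiplicative ℤ := lift fun k => if k = j then .ofAdd 1 else 1
  have := congrArg f hw
  obtain ⟨x, b⟩ := e
  simp only [_root_.map_mul, _root_.map_inv, mul_inv_cancel_comm] at this
  have h₁ : f (of j) = .ofAdd 1 := by simp [f]
  rw [h₁] at this
  cases b
  · have h₂ : mk [(x, false)] = (of x)⁻¹ := rfl
    rw [h₂, _root_.map_inv] at this
    by_cases hx : x = j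
    · subst hx
      rw [h₁] at this
      exact absurd this (by decide)
    · simp [f, hx] at this
  · have h₂ : mk [(x, true)] = of x := rfl
    rw [h₂] at this ⊢
    by_cases hx : x = j
    · rw [hx]
    · simp [f, hx] at this

end FreeGroup

namespace FreeGroup

section

variable {X : Type*}

theorem mem_zpowers_of_commute_of [DecidableEq X] {i : X} {g : FreeGroup X}
    (h : g * of i * g⁻¹ = of i) : g ∈ Subgroup.zpowers (of i) := by
  induction hn : g.norm using Nat.strong_induction_on generalizing g with
  | _ n ih =>
    by_cases hlast : ∀ m l, g.toWord = m ++ [l] → l.1 ≠ i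
    · have h₁ := norm_conj_of_getLast_ne (w := g) (e := (i, true)) hlast
      have h₂ : mk [(i, true)] = of i := rfl
      rw [h₂, h, norm_of] at h₁
      have : g = 1 := norm_eq_zero.1 (by omega)
      rw [this]
      exact one_mem _
    · push Not at hlast
      obtain ⟨m, ⟨j, b⟩, hm, hl⟩ := hlast
      obtain rfl : j = i := hl
      have h₁ : g = mk m * mk [(j, b)] := by rw [mul_mk, ← hm, mk_toWord]
      have h₂ : mk [(j, b)] ∈ Subgroup.zpowers (of j) := by
        cases b
        · exact inv_mem (Subgroup.mem_zpowers (of j))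
        · exact Subgroup.mem_zpowers (of j)
      have h₃ : mk [(j, b)] * of j * (mk [(j, b)])⁻¹ = of j := by
        obtain ⟨k, hk⟩ := h₂
        rw [← hk]
        group
      rw [h₁]
      refine mul_mem (ih (mk m).norm ?_ ?_ rfl) h₂
      · have h₄ : (mk m).norm ≤ m.length := norm_mk_le
        have h₅ : g.norm = m.length + 1 := by simp [norm, hm]
        omega
      · rw [h₁] at h
        conv_lhs => rw [← h₃]
        refine Eq.trans ?_ h
        group

theorem eq_of_conj_of_mem_zpowers {i j : X} {g : FreeGroup X}
    (h : g⁻¹ * of i * g ∈ Subgroup.zpowers (of j)) : i = j := by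
  classical
  obtain ⟨k, hk⟩ := h
  let f : FreeGroup X →* Multiplicative ℤ := lift fun l => if l = i then .ofAdd 1 else 1
  have := congrArg f hk
  by_contra hij
  simp only [_root_.map_mul, _root_.map_inv, map_zpow, inv_mul_cancel_comm] at this
  simp [f, Ne.symm hij] at this
  exact absurd this (by decide)

theorem mem_zpowers_of_conj_mem_zpowers {i : X} {g : FreeGroup X}
    (h : g⁻¹ * of i * g ∈ Subgroup.zpowers (of i)) : g ∈ Subgroup.zpowers (of i) := by
  classical
  obtain ⟨k, hk⟩ := h
  let f : FreeGroup X →* Multiplicative ℤ := lift fun l => if l = i then .ofAdd 1 else 1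
  have := congrArg f hk
  simp only [_root_.map_mul, _root_.map_inv, map_zpow] at this
  have hf : f (of i) = .ofAdd 1 := by simp [f]
  rw [hf, inv_mul_cancel_comm, ← ofAdd_zsmul] at this
  have hk1 : k = 1 := by simpa using this
  subst hk1
  refine mem_zpowers_of_commute_of ?_
  simp only [zpow_one] at hk
  conv_lhs => rw [hk]
  group

end

end FreeGroup

namespace HNNExtension

open NormalWord

variable {G : Type*} [Group G] {x y : G} {φ : Subgroup.zpowers x ≃* Subgroup.zpowers y}

/-- Every element of an HNN extension is represented by a reduced word. -/
theorem exists_reducedWord_prod_eq {A B : Subgroup G} {φ : A ≃* B} (g : HNNExtension G A B φ) :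
    ∃ w : ReducedWord G A B, w.prod φ = g := by
  obtain ⟨d⟩ := TransversalPair.nonempty G A B
  refine ⟨(NormalWord.equiv φ d g).toReducedWord, ?_⟩
  exact (NormalWord.equiv φ d).symm_apply_apply g

theorem ReducedWord.exists_prod_mul_of {A B : Subgroup G} {φ : A ≃* B} (w : ReducedWord G A B)
    (hw : w.toList ≠ []) (c : G) : ∃ w' : ReducedWord G A B, w'.head = w.head ∧
      w'.toList.map Prod.fst = w.toList.map Prod.fst ∧ w'.prod φ = w.prod φ * of c := by
  obtain ⟨g, l, hl⟩ := w
  rcases List.eq_nil_or_concat l with rfl | ⟨l, e, rfl⟩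
  · exact absurd rfl hw
  rw [List.concat_eq_append] at hl
  refine ⟨⟨g, l ++ [(e.1, e.2 * c)], ?_⟩, rfl, by simp, ?_⟩
  · rw [List.isChain_append] at hl ⊢
    refine ⟨hl.1, by simp, ?_⟩
    simpa using hl.2.2
  · simp [ReducedWord.prod, mul_assoc]

/-- The endomorphism of the list part of a word induced by `t ↦ t * x`. -/
def twist (x y : G) (e : ℤˣ × G) : ℤˣ × G := (e.1, (if e.1 = 1 then x else y⁻¹) * e.2)

theorem twist_mem_iff (e : ℤˣ × G) :
    (twist x y e).2 ∈ toSubgroup (Subgroup.zpowers x) (Subgroup.zpowers y) e.1 ↔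
      e.2 ∈ toSubgroup (Subgroup.zpowers x) (Subgroup.zpowers y) e.1 := by
  obtain ⟨u, g⟩ := e
  rcases Int.units_eq_one_or u with rfl | rfl
  · exact Subgroup.mul_mem_cancel_left _ (Subgroup.mem_zpowers x)
  · exact Subgroup.mul_mem_cancel_left _ (inv_mem (Subgroup.mem_zpowers y))

/-- The word obtained from `w` by the substitution `t ↦ t * x`. -/
def twistWord (w : ReducedWord G (Subgroup.zpowers x) (Subgroup.zpowers y)) :
    ReducedWord G (Subgroup.zpowers x) (Subgroup.zpowers y) where
  head := w.head
  toList := w.toList.map (twist x y)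
  chain := by
    rw [List.isChain_map]
    exact w.chain.imp fun a b h h' => h ((twist_mem_iff a).1 h')

variable (hφ : (φ ⟨x, Subgroup.mem_zpowers x⟩ : G) = y)
  {ρ : HNNExtension G _ _ φ →* HNNExtension G _ _ φ} (hρG : ∀ g, ρ (of g) = of g)
  (hρt : ρ t = t * of x)

include hφ hρG hρt

theorem map_zpow_mul_of (e : ℤˣ × G) :
    ρ (t ^ (e.1 : ℤ) * of e.2) = t ^ ((twist x y e).1 : ℤ) * of (twist x y e).2 := by
  obtain ⟨u, g⟩ := e
  rcases Int.units_eq_one_or u with rfl | rfl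
  · simp [twist, hρG, hρt, mul_assoc]
  · have h := t_mul_of (φ := φ) ⟨x, Subgroup.mem_zpowers x⟩
    rw [hφ] at h
    have : (-1 : ℤˣ) ≠ 1 := by decide
    simp [twist, hρG, hρt, mul_assoc, this, h]

theorem prod_twistWord (w : ReducedWord G (Subgroup.zpowers x) (Subgroup.zpowers y)) :
    (twistWord w).prod φ = ρ (w.prod φ) := by
  simp only [ReducedWord.prod, twistWord, map_mul, hρG, map_list_prod, List.map_map]
  congr 3
  funext e
  simp only [Function.comp_apply]
  rw [map_zpow_mul_of hφ hρG hρt]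

/-- An element which is multiplied by an element of the base group under `t ↦ t * x` involves
at most one stable letter. -/
theorem exists_of_map_eq_mul_of
    (hx : ∀ g : G, g⁻¹ * x * g ∈ Subgroup.zpowers x → g ∈ Subgroup.zpowers x)
    (hy : ∀ g : G, g⁻¹ * y * g ∈ Subgroup.zpowers y → g ∈ Subgroup.zpowers y)
    (hxy : ∀ g : G, g⁻¹ * x * g ∉ Subgroup.zpowers y)
    (hyx : ∀ g : G, g⁻¹ * y * g ∉ Subgroup.zpowers x)
    {a : HNNExtension G _ _ φ} {c : G} (ha : ρ a = a * of c) :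
    (c = 1 ∧ ∃ g, a = of g) ∨ (∃ g h, a = of g * t * of h ∧ c = h⁻¹ * x * h) ∨
      ∃ g h, a = of g * t⁻¹ * of h ∧ c = h⁻¹ * y⁻¹ * h := by
  obtain ⟨⟨g, l, hl⟩, rfl⟩ := exists_reducedWord_prod_eq a
  rcases l with _ | ⟨⟨u, g₁⟩, l⟩
  · left
    simp only [ReducedWord.prod, List.map_nil, List.prod_nil, mul_one, hρG] at ha ⊢
    refine ⟨of_injective (φ := φ) ?_, g, rfl⟩
    simpa using ha
  right
  let w : ReducedWord G (Subgroup.zpowers x) (Subgroup.zpowers y) := ⟨g₁, l, hl.tail⟩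
  set s := if u = 1 then x else y⁻¹ with hs
  have hw : ReducedWord.prod φ ⟨g, (u, g₁) :: l, hl⟩ = of g * t ^ (u : ℤ) * w.prod φ := by
    simp [ReducedWord.prod, w, mul_assoc]
  have hρu : ρ (t ^ (u : ℤ)) = t ^ (u : ℤ) * of s := by
    have := map_zpow_mul_of hφ hρG hρt (u, 1)
    simpa [twist] using this
  rw [hw] at ha ⊢
  simp only [map_mul, hρG, hρu, mul_assoc, mul_right_inj] at ha
  have hl_nil : l = [] := by
    by_contra hne
    obtain ⟨⟨u₂, g₂⟩, l', rfl⟩ := List.exists_cons_of_ne_nil hne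
    obtain ⟨w', hw'h, -, hw'p⟩ := ReducedWord.exists_prod_mul_of (φ := φ) w hne c
    let v : ReducedWord G (Subgroup.zpowers x) (Subgroup.zpowers y) :=
      ⟨s * g₁, (twistWord w).toList, (twistWord w).chain⟩
    have hv : v.prod φ = w'.prod φ := by
      rw [hw'p, ← ha, ← prod_twistWord hφ hρG hρt]
      simp [ReducedWord.prod, v, twistWord, w, mul_assoc]
    have h₁ := (ReducedWord.map_fst_eq_and_of_prod_eq φ hv).2 u₂ (by simp [v, twistWord, twist, w])
    rw [hw'h] at h₁
    have h₂ : g₁⁻¹ * s⁻¹ * g₁ ∈ toSubgroup (Subgroup.zpowers x) (Subgroup.zpowers y) (-u₂) := by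
      simpa [v, w] using h₁
    have h₃ := (List.isChain_cons_cons.1 hl).1
    rcases Int.units_eq_one_or u with rfl | rfl
    · replace h₂ := inv_mem h₂
      simp only [hs, if_true, mul_inv_rev, inv_inv, ← mul_assoc] at h₂
      rcases Int.units_eq_one_or u₂ with rfl | rfl
      · exact hxy _ h₂
      · rw [neg_neg] at h₂
        exact absurd (show (1 : ℤˣ) = -1 from h₃ (hx _ h₂)) (by decide)
    · have h₄ : (-1 : ℤˣ) ≠ 1 := by decide
      simp only [hs, h₄, if_false, inv_inv] at h₂
      rcases Int.units_eq_one_or u₂ with rfl | rfl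
      · exact absurd (show (-1 : ℤˣ) = 1 from h₃ (hy _ h₂)) (by decide)
      · rw [neg_neg] at h₂
        exact hyx _ h₂
  subst hl_nil
  have hwg : w.prod φ = of g₁ := by simp [ReducedWord.prod, w]
  rw [hwg, hρG, ← map_mul, ← map_mul] at ha
  have hc : c = g₁⁻¹ * s * g₁ := by
    rw [mul_assoc, of_injective (φ := φ) ha, inv_mul_cancel_left]
  rw [hwg]
  rcases Int.units_eq_one_or u with rfl | rfl
  · exact Or.inl ⟨g, g₁, by simp, by simpa [hs] using hc⟩
  · have h₄ : (-1 : ℤˣ) ≠ 1 := by decide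
    exact Or.inr ⟨g, g₁, by simp, by simpa [hs, h₄] using hc⟩

end HNNExtension

namespace FreeGroup

variable {X : Type*} [DecidableEq X]

/-- The substitution `a ↦ a b a⁻¹`. -/
def conjSubst (a b : X) : FreeGroup X →* FreeGroup X :=
  lift fun i => if i = a then of a * of b * (of a)⁻¹ else of i

@[simp]
theorem conjSubst_of_self (a b : X) : conjSubst a b (of a) = of a * of b * (of a)⁻¹ := by
  simp [conjSubst]

theorem conjSubst_of_ne {a b i : X} (h : i ≠ a) : conjSubst a b (of i) = of i := by
  simp [conjSubst, h]

theorem exists_zpowers_mulEquiv (a b : X) :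
    ∃ φ : Subgroup.zpowers (of b) ≃* Subgroup.zpowers (of a),
      (φ ⟨of b, Subgroup.mem_zpowers (of b)⟩ : FreeGroup X) = of a := by
  have h : (Subgroup.zpowers (of b)).map (freeGroupCongr (Equiv.swap a b)).toMonoidHom =
      Subgroup.zpowers (of a) := by
    rw [MonoidHom.map_zpowers]
    simp
  refine ⟨((freeGroupCongr (Equiv.swap a b)).subgroupMap _).trans (MulEquiv.subgroupCongr h), ?_⟩
  change freeGroupCongr (Equiv.swap a b) (of b) = of a
  simp

theorem exists_mulEquiv_hnnExtension {a b : X} (hab : a ≠ b) :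
    ∃ (φ : Subgroup.zpowers (of b) ≃* Subgroup.zpowers (of a))
      (θ : HNNExtension (FreeGroup X) _ _ φ ≃* FreeGroup X),
      (φ ⟨of b, Subgroup.mem_zpowers (of b)⟩ : FreeGroup X) = of a ∧
      θ HNNExtension.t = of a ∧ ∀ g, θ (HNNExtension.of g) = conjSubst a b g := by
  obtain ⟨φ, hφ⟩ := exists_zpowers_mulEquiv a b
  have hφ' : ∀ z : Subgroup.zpowers (of b),
      of a * conjSubst a b z = conjSubst a b (φ z) * of a := by
    rintro ⟨z, k, rfl⟩
    have h₁ : (⟨of b ^ k, k, rfl⟩ : Subgroup.zpowers (of b)) =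
        ⟨of b, Subgroup.mem_zpowers (of b)⟩ ^ k := rfl
    simp only [h₁, map_zpow, SubgroupClass.coe_zpow, hφ, conjSubst_of_self,
      conjSubst_of_ne hab.symm, conj_zpow]
    group
  let θ : HNNExtension (FreeGroup X) _ _ φ →* FreeGroup X :=
    HNNExtension.lift (conjSubst a b) (of a) hφ'
  let ψ : FreeGroup X →* HNNExtension (FreeGroup X) _ _ φ :=
    lift fun i => if i = a then HNNExtension.t else HNNExtension.of (of i)
  have h₁ : ψ.comp θ = MonoidHom.id _ := by
    ext i
    · by_cases hi : i = a
      · subst hi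
        have := HNNExtension.equiv_eq_conj (φ := φ) ⟨of b, Subgroup.mem_zpowers (of b)⟩
        rw [hφ] at this
        simp [θ, ψ, conjSubst_of_ne hab.symm, hab.symm, this]
      · simp [θ, ψ, conjSubst_of_ne hi, hi]
    · simp [θ, ψ]
  have h₂ : θ.comp ψ = MonoidHom.id _ := by
    ext i
    by_cases hi : i = a
    · simp [θ, ψ, hi]
    · simp [θ, ψ, hi, conjSubst_of_ne hi]
  exact ⟨φ, MonoidHom.toMulEquiv θ ψ h₁ h₂, hφ, by simp [θ], by simp [θ]⟩

theorem conjSubst_injective {a b : X} (hab : a ≠ b) : Function.Injective (conjSubst a b) := by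
  obtain ⟨φ, θ, -, -, h⟩ := exists_mulEquiv_hnnExtension hab
  have : (conjSubst a b : FreeGroup X → FreeGroup X) = θ ∘ HNNExtension.of :=
    funext fun g => (h g).symm
  rw [this]
  exact θ.injective.comp (HNNExtension.of_injective φ)

section

variable {a b : X} (hab : a ≠ b) {ρ : FreeGroup X →* FreeGroup X} (hρa : ρ (of a) = of a * of b)
  (hρ : ∀ i ≠ a, ρ (of i) = of i)

include hab hρa hρ

theorem map_conjSubst (g : FreeGroup X) : ρ (conjSubst a b g) = conjSubst a b g := by
  have : ρ.comp (conjSubst a b) = conjSubst a b := by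
    ext i
    by_cases hi : i = a
    · subst hi
      simp [hρa, hρ b hab.symm]
    · simp [conjSubst_of_ne hi, hρ i hi]
  exact DFunLike.congr_fun this g

theorem exists_of_map_eq_mul_conjSubst {w c : FreeGroup X} (h : ρ w = w * conjSubst a b c) :
    (c = 1 ∧ ∃ g, w = conjSubst a b g) ∨
    (∃ g h, w = conjSubst a b g * of a * conjSubst a b h ∧ c = h⁻¹ * of b * h) ∨
      ∃ g h, w = conjSubst a b g * (of a)⁻¹ * conjSubst a b h ∧ c = h⁻¹ * (of a)⁻¹ * h := by
  obtain ⟨φ, θ, hφ, hθt, hθ⟩ := exists_mulEquiv_hnnExtension hab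
  let ρ' : HNNExtension (FreeGroup X) _ _ φ →* HNNExtension (FreeGroup X) _ _ φ :=
    θ.symm.toMonoidHom.comp (ρ.comp θ.toMonoidHom)
  have hρ' : ∀ z, θ (ρ' z) = ρ (θ z) := fun z => by simp [ρ']
  have h₁ : ∀ g, ρ' (HNNExtension.of g) = HNNExtension.of g := fun g => θ.injective <| by
    rw [hρ', hθ, map_conjSubst hab hρa hρ]
  have h₂ : ρ' HNNExtension.t = HNNExtension.t * HNNExtension.of (of b) := θ.injective <| by
    rw [hρ', _root_.map_mul, hθ, hθt, hρa, conjSubst_of_ne hab.symm]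
  obtain ⟨z, rfl⟩ := θ.surjective w
  have h₃ : ρ' z = z * HNNExtension.of c := θ.injective <| by
    rw [hρ', _root_.map_mul, hθ, h]
  rcases HNNExtension.exists_of_map_eq_mul_of hφ h₁ h₂ (fun g => mem_zpowers_of_conj_mem_zpowers)
    (fun g => mem_zpowers_of_conj_mem_zpowers) (fun g hg => hab (eq_of_conj_of_mem_zpowers hg).symm)
    (fun g hg => hab (eq_of_conj_of_mem_zpowers hg)) h₃ with
    ⟨hc, g, rfl⟩ | ⟨g, k, rfl, hc⟩ | ⟨g, k, rfl, hc⟩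
  · exact Or.inl ⟨hc, g, hθ g⟩
  · exact Or.inr (Or.inl ⟨g, k, by simp [hθ, hθt], hc⟩)
  · exact Or.inr (Or.inr ⟨g, k, by simp [hθ, hθt], hc⟩)

theorem mem_range_conjSubst_iff (w : FreeGroup X) :
    w ∈ (conjSubst a b).range ↔ ρ w = w := by
  refine ⟨?_, fun h => ?_⟩
  · rintro ⟨g, rfl⟩
    exact map_conjSubst hab hρa hρ g
  · rcases exists_of_map_eq_mul_conjSubst hab hρa hρ (w := w) (c := 1) (by simpa using h) with
      ⟨-, g, rfl⟩ | ⟨g, k, -, hc⟩ | ⟨g, k, -, hc⟩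
    · exact ⟨g, rfl⟩
    · have := conj_eq_one_iff.1 ((inv_inv k).symm ▸ hc.symm : k⁻¹ * of b * (k⁻¹)⁻¹ = 1)
      exact absurd this (of_ne_one b)
    · have := conj_eq_one_iff.1 ((inv_inv k).symm ▸ hc.symm : k⁻¹ * (of a)⁻¹ * (k⁻¹)⁻¹ = 1)
      exact absurd (inv_eq_one.1 this) (of_ne_one a)

end

end FreeGroup

namespace FreeGroup

open scoped commutatorElement

variable {X : Type*}

theorem mulAut_ext {α β : MulAut (FreeGroup X)} (h : ∀ i, α (of i) = β (of i)) : α = β := by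
  have : α.toMonoidHom = β.toMonoidHom := FreeGroup.ext_hom _ _ h
  exact MulEquiv.ext fun g => DFunLike.congr_fun this g

theorem apply_eq_self_of_mem_closure {T : Set X} {f : FreeGroup X →* FreeGroup X}
    (h : ∀ i ∈ T, f (of i) = of i) {u : FreeGroup X} (hu : u ∈ Subgroup.closure (of '' T)) :
    f u = u := by
  have : Subgroup.closure (of '' T) ≤ f.eqLocus (MonoidHom.id _) := by
    rw [Subgroup.closure_le]
    rintro _ ⟨i, hi, rfl⟩
    exact h i hi
  exact this hu

theorem of_mem_closure {T : Set X} {i : X} (hi : i ∈ T) :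
    of i ∈ Subgroup.closure (of '' T) := Subgroup.subset_closure ⟨i, hi, rfl⟩

theorem mk_singleton_mem_closure {T : Set X} {e : X × Bool} (he : e.1 ∈ T) :
    mk [e] ∈ Subgroup.closure (of '' T) := by
  obtain ⟨i, b⟩ := e
  cases b
  · exact inv_mem (of_mem_closure he)
  · exact of_mem_closure he

section

variable [DecidableEq X]

/-- Multiplying a basis element by words in the other basis elements gives an automorphism. -/
theorem exists_mulAut_mul (j : X) {u v : FreeGroup X}
    (hu : u ∈ Subgroup.closure (of '' {j}ᶜ)) (hv : v ∈ Subgroup.closure (of '' {j}ᶜ)) :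
    ∃ α : MulAut (FreeGroup X), α (of j) = u * of j * v ∧ ∀ k ≠ j, α (of k) = of k := by
  let f (u v : FreeGroup X) : FreeGroup X →* FreeGroup X :=
    lift (Function.update of j (u * of j * v))
  have hf : ∀ u v, f u v (of j) = u * of j * v := fun u v => by simp [f]
  have hfk : ∀ u v, ∀ k ≠ j, f u v (of k) = of k := fun u v k hk => by simp [f, hk]
  have key : ∀ u ∈ Subgroup.closure (of '' {j}ᶜ), ∀ v ∈ Subgroup.closure (of '' {j}ᶜ),
      (f u v).comp (f u⁻¹ v⁻¹) = MonoidHom.id _ := by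
    intro u hu v hv
    ext k
    by_cases hk : k = j
    · subst hk
      have h := fun {w} => apply_eq_self_of_mem_closure (T := {k}ᶜ) (u := w) (hfk u v)
      simp only [MonoidHom.comp_apply, hf, _root_.map_mul, _root_.map_inv, h hu, h hv,
        MonoidHom.id_apply]
      group
    · simp [hfk _ _ k hk]
  exact ⟨MonoidHom.toMulEquiv (f u v) (f u⁻¹ v⁻¹)
    (by simpa using key u⁻¹ (inv_mem hu) v⁻¹ (inv_mem hv)) (key u hu v hv), hf u v, hfk u v⟩

end

/-- The inversion of a single basis element. -/
theorem exists_mulAut_inv [DecidableEq X] (j : X) :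
    ∃ α : MulAut (FreeGroup X), α (of j) = (of j)⁻¹ ∧ ∀ k ≠ j, α (of k) = of k := by
  let f : FreeGroup X →* FreeGroup X := lift (Function.update of j (of j)⁻¹)
  have hf : f (of j) = (of j)⁻¹ := by simp [f]
  have hfk : ∀ k ≠ j, f (of k) = of k := fun k hk => by simp [f, hk]
  have key : f.comp f = MonoidHom.id _ := by
    ext k
    by_cases hk : k = j
    · subst hk
      simp [hf]
    · simp [hfk k hk]
  exact ⟨MonoidHom.toMulEquiv f f key key, hf, hfk⟩

/-- If `α * σ * β = β * α` then `σ` is a commutator. -/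
theorem eq_commutatorElement_of_mul_eq {G : Type*} [Group G] {α σ β : G}
    (h : α * σ * β = β * α) : σ = ⁅α⁻¹, β⁆ := by
  rw [commutatorElement_def, inv_inv, mul_assoc α⁻¹, ← h]
  group

section

variable [DecidableEq X] {T : Set X} {S : Subgroup (MulAut (FreeGroup X))}
  (hS : ∀ α β : MulAut (FreeGroup X), (∀ j ∈ T, α (of j) = of j) → (∀ j ∈ T, β (of j) = of j) →
    ⁅α, β⁆ ∈ S)

include hS

theorem exists_mul_right_mem {j k : X} (hj : j ∉ T) (hk : k ∉ T) (hkj : k ≠ j) {d : X × Bool}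
    (hdj : d.1 ≠ j) (hdk : d.1 ≠ k) :
    ∃ σ ∈ S, σ (of j) = of j * mk [d] ∧ ∀ l ≠ j, σ (of l) = of l := by
  obtain ⟨A, hA, hA'⟩ := exists_mulAut_mul j (one_mem _) (of_mem_closure (T := {j}ᶜ) hkj)
  obtain ⟨B, hB, hB'⟩ := exists_mulAut_mul k (one_mem _) (mk_singleton_mem_closure (T := {k}ᶜ) hdk)
  obtain ⟨σ, hσ, hσ'⟩ :=
    exists_mulAut_mul j (one_mem _) (mk_singleton_mem_closure (T := {j}ᶜ) hdj)
  simp only [one_mul] at hA hB hσ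
  refine ⟨σ, ?_, hσ, hσ'⟩
  have hAd : A (mk [d]) = mk [d] :=
    apply_eq_self_of_mem_closure (f := A.toMonoidHom) hA' (mk_singleton_mem_closure hdj)
  have hσd : σ (mk [d]) = mk [d] :=
    apply_eq_self_of_mem_closure (f := σ.toMonoidHom) hσ' (mk_singleton_mem_closure hdj)
  have h : A * σ * B = B * A := mulAut_ext fun l => by
    by_cases hlj : l = j
    · subst hlj
      simp [hB' _ hkj.symm, hσ, hA, hAd, hB, mul_assoc]
    by_cases hlk : l = k
    · subst hlk
      simp [hB, hσ' _ hkj, hσd, hA' _ hkj, hAd]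
    simp [hA' _ hlj, hσ' _ hlj, hB' _ hlk]
  rw [eq_commutatorElement_of_mul_eq h]
  refine hS _ _ (fun l hl => ?_) fun l hl => hB' _ (ne_of_mem_of_not_mem hl hk)
  rw [MulAut.inv_apply, MulEquiv.symm_apply_eq, hA' _ (ne_of_mem_of_not_mem hl hj)]

theorem exists_mul_left_mem {j k : X} (hj : j ∉ T) (hk : k ∉ T) (hkj : k ≠ j) {d : X × Bool}
    (hdj : d.1 ≠ j) (hdk : d.1 ≠ k) :
    ∃ σ ∈ S, σ (of j) = mk [d] * of j ∧ ∀ l ≠ j, σ (of l) = of l := by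
  obtain ⟨A, hA, hA'⟩ := exists_mulAut_mul j (of_mem_closure (T := {j}ᶜ) hkj) (one_mem _)
  obtain ⟨B, hB, hB'⟩ := exists_mulAut_mul k (mk_singleton_mem_closure (T := {k}ᶜ) hdk) (one_mem _)
  obtain ⟨σ, hσ, hσ'⟩ :=
    exists_mulAut_mul j (mk_singleton_mem_closure (T := {j}ᶜ) hdj) (one_mem _)
  simp only [mul_one] at hA hB hσ
  refine ⟨σ, ?_, hσ, hσ'⟩
  have hAd : A (mk [d]) = mk [d] :=
    apply_eq_self_of_mem_closure (f := A.toMonoidHom) hA' (mk_singleton_mem_closure hdj)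
  have hσd : σ (mk [d]) = mk [d] :=
    apply_eq_self_of_mem_closure (f := σ.toMonoidHom) hσ' (mk_singleton_mem_closure hdj)
  have h : A * σ * B = B * A := mulAut_ext fun l => by
    by_cases hlj : l = j
    · subst hlj
      simp [hB' _ hkj.symm, hσ, hA, hAd, hB, mul_assoc]
    by_cases hlk : l = k
    · subst hlk
      simp [hB, hσ' _ hkj, hσd, hA' _ hkj, hAd]
    simp [hA' _ hlj, hσ' _ hlj, hB' _ hlk]
  rw [eq_commutatorElement_of_mul_eq h]
  refine hS _ _ (fun l hl => ?_) fun l hl => hB' _ (ne_of_mem_of_not_mem hl hk)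
  rw [MulAut.inv_apply, MulEquiv.symm_apply_eq, hA' _ (ne_of_mem_of_not_mem hl hj)]

end

end FreeGroup

namespace FreeGroup

open scoped commutatorElement

variable {X : Type*} [DecidableEq X] {T : Set X} {S : Subgroup (MulAut (FreeGroup X))}

omit [DecidableEq X] in
theorem isConj_apply_inv {α : MulAut (FreeGroup X)} {g : FreeGroup X} (h : IsConj g (α g)) :
    IsConj g (α⁻¹ g) := by
  obtain ⟨w, hw⟩ := isConj_iff.1 h
  refine isConj_iff.2 ⟨(α⁻¹ w)⁻¹, ?_⟩
  have := congrArg (α⁻¹ : MulAut (FreeGroup X)) hw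
  simp only [_root_.map_mul, _root_.map_inv, MulAut.inv_apply_self] at this
  generalize α⁻¹ g = y at this ⊢
  rw [← this]
  group

section

variable (hS : ∀ α β : MulAut (FreeGroup X), (∀ j ∈ T, IsConj (of j) (α (of j))) →
  (∀ j ∈ T, IsConj (of j) (β (of j))) → ⁅α, β⁆ ∈ S)

include hS

theorem exists_conj_mem {j k : X} (hj : j ∈ T) (hk : k ∉ T) {d : X × Bool}
    (hdj : d.1 ≠ j) (hdk : d.1 ≠ k) :
    ∃ σ ∈ S, σ (of j) = (mk [d])⁻¹ * of j * mk [d] ∧ ∀ l ≠ j, σ (of l) = of l := by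
  have hkj : k ≠ j := (ne_of_mem_of_not_mem hj hk).symm
  obtain ⟨A, hA, hA'⟩ := exists_mulAut_mul j (inv_mem (of_mem_closure (T := {j}ᶜ) hkj))
    (of_mem_closure (T := {j}ᶜ) hkj)
  obtain ⟨B, hB, hB'⟩ := exists_mulAut_mul k (one_mem _) (mk_singleton_mem_closure (T := {k}ᶜ) hdk)
  obtain ⟨σ, hσ, hσ'⟩ := exists_mulAut_mul j (inv_mem (mk_singleton_mem_closure (T := {j}ᶜ) hdj))
    (mk_singleton_mem_closure (T := {j}ᶜ) hdj)
  simp only [one_mul] at hB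
  refine ⟨σ, ?_, hσ, hσ'⟩
  have hAd : A (mk [d]) = mk [d] :=
    apply_eq_self_of_mem_closure (f := A.toMonoidHom) hA' (mk_singleton_mem_closure hdj)
  have hσd : σ (mk [d]) = mk [d] :=
    apply_eq_self_of_mem_closure (f := σ.toMonoidHom) hσ' (mk_singleton_mem_closure hdj)
  have h : A * σ * B = B * A := mulAut_ext fun l => by
    by_cases hlj : l = j
    · subst hlj
      simp only [MulAut.mul_apply, hB' _ hkj.symm, hσ, hA, _root_.map_mul, _root_.map_inv, hAd, hB]
      group
    by_cases hlk : l = k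
    · subst hlk
      simp only [MulAut.mul_apply, hB, hσ' _ hkj, hσd, hA' _ hkj, hAd, _root_.map_mul]
    simp only [MulAut.mul_apply, hA' _ hlj, hσ' _ hlj, hB' _ hlk]
  rw [eq_commutatorElement_of_mul_eq h]
  refine hS _ _ (fun l hl => isConj_apply_inv ?_) fun l hl => ?_
  · by_cases hlj : l = j
    · subst hlj
      rw [hA]
      exact isConj_iff.2 ⟨(of k)⁻¹, by group⟩
    · rw [hA' _ hlj]
  · rw [hB' _ (ne_of_mem_of_not_mem hl hk)]

end

omit [DecidableEq X] in
theorem exists_rotation_mem {i j : X} (hij : i ≠ j) (hi : i ∉ T) (hj : j ∉ T)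
    (hleft : ∀ j ∉ T, ∀ d : X × Bool, d.1 ≠ j → ∃ σ ∈ S,
      σ (of j) = mk [d] * of j ∧ ∀ k ≠ j, σ (of k) = of k)
    (hright : ∀ j ∉ T, ∀ d : X × Bool, d.1 ≠ j → ∃ σ ∈ S,
      σ (of j) = of j * mk [d] ∧ ∀ k ≠ j, σ (of k) = of k) :
    ∃ σ ∈ S, σ (of i) = of j ∧ σ (of j) = (of i)⁻¹ ∧ ∀ k, k ≠ i → k ≠ j → σ (of k) = of k := by
  obtain ⟨U, hU, hUi, hUk⟩ := hright i hi (j, true) hij.symm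
  obtain ⟨V, hV, hVj, hVk⟩ := hleft j hj (i, false) hij
  obtain ⟨W, hW, hWi, hWk⟩ := hleft i hi (j, true) hij.symm
  have h₁ : mk [(j, true)] = of j := rfl
  have h₂ : mk [(i, false)] = (of i)⁻¹ := rfl
  rw [h₁] at hUi hWi
  rw [h₂] at hVj
  refine ⟨W * V * U, S.mul_mem (S.mul_mem hW hV) hU, ?_, ?_, fun k hki hkj => ?_⟩
  · simp only [MulAut.mul_apply, hUi, _root_.map_mul, hVk i hij, hVj, hWk j hij.symm,
      _root_.map_inv]
    group
  · simp only [MulAut.mul_apply, hUk j hij.symm, hVj, _root_.map_mul, _root_.map_inv, hWi,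
      hWk j hij.symm]
    group
  · simp only [MulAut.mul_apply, hUk k hki, hVk k hkj, hWk k hki]

theorem exists_inversion_mem
    (hrot : ∀ i ∉ T, ∀ j ∉ T, i ≠ j → ∃ σ ∈ S, σ (of i) = of j ∧ σ (of j) = (of i)⁻¹ ∧
      ∀ k, k ≠ i → k ≠ j → σ (of k) = of k)
    (hinv : ∃ i ∉ T, ∃ σ ∈ S, σ (of i) = (of i)⁻¹ ∧ ∀ k ≠ i, σ (of k) = of k) {j : X}
    (hj : j ∉ T) : ∃ σ ∈ S, σ (of j) = (of j)⁻¹ ∧ ∀ k ≠ j, σ (of k) = of k := by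
  obtain ⟨i, hi, s, hs, hsi, hsk⟩ := hinv
  by_cases hij : i = j
  · subst hij
    exact ⟨s, hs, hsi, hsk⟩
  obtain ⟨w, hw, hwi, hwj, hwk⟩ := hrot i hi j hj hij
  have h₁ : w⁻¹ (of j) = of i := by rw [← hwi, MulAut.inv_apply_self]
  have h₂ : w⁻¹ (of i) = (of j)⁻¹ := by
    rw [← inv_inv (of i), ← hwj, _root_.map_inv, MulAut.inv_apply_self]
  refine ⟨w * s * w⁻¹, S.mul_mem (S.mul_mem hw hs) (S.inv_mem hw), ?_, fun k hk => ?_⟩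
  · simp only [MulAut.mul_apply, h₁, hsi, hwi, _root_.map_inv]
  · by_cases hki : k = i
    · subst hki
      simp only [MulAut.mul_apply, h₂, hsk j hk.symm, hwj, _root_.map_inv, inv_inv]
    · have h₃ : w⁻¹ (of k) = of k := by
        conv_lhs => rw [← hwk k hki hk]
        rw [MulAut.inv_apply_self]
      simp only [MulAut.mul_apply, h₃, hsk k hki, hwk k hki hk]

theorem mem_of_signed_perm [Fintype X]
    (hrot : ∀ i ∉ T, ∀ j ∉ T, i ≠ j → ∃ σ ∈ S, σ (of i) = of j ∧ σ (of j) = (of i)⁻¹ ∧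
      ∀ k, k ≠ i → k ≠ j → σ (of k) = of k)
    (hinv : ∀ j ∉ T, ∃ σ ∈ S, σ (of j) = (of j)⁻¹ ∧ ∀ k ≠ j, σ (of k) = of k)
    {α : MulAut (FreeGroup X)} (hα : ∀ j ∈ T, α (of j) = of j)
    (hα' : ∀ i, ∃ e : X × Bool, α (of i) = mk [e]) : α ∈ S := by
  induction hn : (Finset.univ.filter fun i => α (of i) ≠ of i).card using Nat.strong_induction_on
    generalizing α with
  | _ n ih =>
    by_cases hfix : ∀ i, α (of i) = of i
    · rw [show α = 1 from mulAut_ext hfix]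
      exact S.one_mem
    push Not at hfix
    obtain ⟨i, hi⟩ := hfix
    obtain ⟨⟨k, b⟩, he⟩ := hα' i
    have hiT : i ∉ T := fun h => hi (hα i h)
    have hkl : ∀ l, α (of l) = of l → l ≠ k := by
      rintro l hl rfl
      cases b
      · have : α (of i) = α (of l)⁻¹ := by rw [he, _root_.map_inv, hl]; rfl
        have := congrArg toWord (α.injective this)
        simp [invRev] at this
      · have : α (of i) = α (of l) := by rw [he, hl]; rfl
        obtain rfl := of_injective (α.injective this)
        exact hi hl
    have hkT : k ∉ T := fun h => hkl k (hα k h) rfl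
    obtain ⟨γ, hγ, hγi, hγl, hγe⟩ : ∃ γ ∈ S, γ (mk [(k, b)]) = of i ∧
        (∀ l, l ≠ i → l ≠ k → γ (of l) = of l) ∧ ∀ l, ∃ e : X × Bool, γ (of l) = mk [e] := by
      by_cases hki : k = i
      · subst hki
        have hb : b = false := by
          by_contra h
          rw [Bool.not_eq_false] at h
          subst h
          exact hi he
        subst hb
        obtain ⟨s, hs, hsi, hsk⟩ := hinv k hiT
        refine ⟨s, hs, ?_, fun l hl _ => hsk l hl, fun l => ?_⟩
        · have : mk [(k, false)] = (of k)⁻¹ := rfl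
          rw [this, _root_.map_inv, hsi, inv_inv]
        · by_cases hl : l = k
          · subst hl
            exact ⟨(l, false), hsi⟩
          · exact ⟨(l, true), hsk l hl⟩
      · cases b
        · obtain ⟨w, hw, hwi, hwk, hwl⟩ := hrot i hiT k hkT (Ne.symm hki)
          refine ⟨w, hw, ?_, hwl, fun l => ?_⟩
          · have : mk [(k, false)] = (of k)⁻¹ := rfl
            rw [this, _root_.map_inv, hwk, inv_inv]
          · by_cases hli : l = i
            · subst hli
              exact ⟨(k, true), hwi⟩
            by_cases hlk : l = k
            · subst hlk
              exact ⟨(i, false), hwk⟩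
            exact ⟨(l, true), hwl l hli hlk⟩
        · obtain ⟨w, hw, hwk, hwi, hwl⟩ := hrot k hkT i hiT hki
          refine ⟨w, hw, hwk, fun l hl hl' => hwl l hl' hl, fun l => ?_⟩
          by_cases hli : l = i
          · subst hli
            exact ⟨(k, false), hwi⟩
          by_cases hlk : l = k
          · subst hlk
            exact ⟨(i, true), hwk⟩
          exact ⟨(l, true), hwl l hlk hli⟩
    have hfix : ∀ l, α (of l) = of l → (γ * α) (of l) = of l := fun l hl => by
      rw [MulAut.mul_apply, hl, hγl l (fun h => hi (h ▸ hl)) (hkl l hl)]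
    have hi' : (γ * α) (of i) = of i := by rw [MulAut.mul_apply, he, hγi]
    suffices γ * α ∈ S by simpa using S.mul_mem (S.inv_mem hγ) this
    refine ih _ ?_ (fun j hj => hfix j (hα j hj)) (fun l => ?_) rfl
    · rw [← hn]
      refine Finset.card_lt_card (Finset.ssubset_iff_subset_ne.2 ⟨fun l hl => ?_, fun h => ?_⟩)
      · simp only [Finset.mem_filter, Finset.mem_univ, true_and] at hl ⊢
        exact fun h => hl (hfix l h)
      · have : i ∈ Finset.univ.filter fun i => α (of i) ≠ of i := by simpa using hi
        rw [← h] at this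
        exact (Finset.mem_filter.1 this).2 hi'
    · obtain ⟨⟨x, c⟩, hx⟩ := hα' l
      obtain ⟨⟨y, c'⟩, hy⟩ := hγe x
      rw [MulAut.mul_apply, hx]
      cases c
      · refine ⟨(y, !c'), ?_⟩
        have := map_mk_singleton_not γ (x, true)
        have h₂ : mk [(x, true)] = of x := rfl
        rw [h₂, hy] at this
        simp only [Bool.not_true] at this
        rw [this, inv_mk]
        rfl
      · exact ⟨(y, c'), hy⟩

/-- A group of automorphisms which contains the commutators of automorphisms preserving the
conjugacy classes of the letters in `T` and one inversion contains all automorphisms preserving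
these conjugacy classes. -/
theorem mem_of_isConj_of_commutator [Fintype X]
    (hS : ∀ α β : MulAut (FreeGroup X), (∀ j ∈ T, IsConj (of j) (α (of j))) →
      (∀ j ∈ T, IsConj (of j) (β (of j))) → ⁅α, β⁆ ∈ S)
    (hT : ∀ i j, ∃ k ∉ T, k ≠ i ∧ k ≠ j)
    (hinv : ∃ i ∉ T, ∃ σ ∈ S, σ (of i) = (of i)⁻¹ ∧ ∀ k ≠ i, σ (of k) = of k)
    {α : MulAut (FreeGroup X)} (hα : ∀ j ∈ T, IsConj (of j) (α (of j))) : α ∈ S := by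
  have hS' : ∀ α β : MulAut (FreeGroup X), (∀ j ∈ T, α (of j) = of j) →
      (∀ j ∈ T, β (of j) = of j) → ⁅α, β⁆ ∈ S := fun α β hα hβ =>
    hS α β (fun j hj => by rw [hα j hj]) fun j hj => by rw [hβ j hj]
  have hleft : ∀ j ∉ T, ∀ d : X × Bool, d.1 ≠ j → ∃ σ ∈ S,
      σ (of j) = mk [d] * of j ∧ ∀ k ≠ j, σ (of k) = of k := by
    intro j hj d hd
    obtain ⟨k, hk, hkj, hkd⟩ := hT j d.1
    exact exists_mul_left_mem hS' hj hk hkj hd hkd.symm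
  have hright : ∀ j ∉ T, ∀ d : X × Bool, d.1 ≠ j → ∃ σ ∈ S,
      σ (of j) = of j * mk [d] ∧ ∀ k ≠ j, σ (of k) = of k := by
    intro j hj d hd
    obtain ⟨k, hk, hkj, hkd⟩ := hT j d.1
    exact exists_mul_right_mem hS' hj hk hkj hd hkd.symm
  have hrot := fun i (hi : i ∉ T) j (hj : j ∉ T) (hij : i ≠ j) =>
    exists_rotation_mem hij hi hj hleft hright
  refine mem_of_isConj (fun j hj d hd => ?_) (fun j hj d hd => ?_) hright
    (fun α hα hα' => mem_of_signed_perm hrot (fun j hj => exists_inversion_mem hrot hinv hj) hα hα')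
    hα
  · obtain ⟨k, hk, hkj, hkd⟩ := hT j d.1
    exact exists_conj_mem hS hj hk hd hkd.symm
  · have : (mk [d])⁻¹ = mk [(d.1, !d.2)] := by rw [inv_mk]; rfl
    rw [this]
    exact hleft j hj _ hd

end FreeGroup

namespace FreeGroup

open scoped commutatorElement

variable {X : Type*} [DecidableEq X]

/-- The automorphisms induced on the source of `conjSubst a b` by a group of automorphisms of its
target. -/
def inducedMulAut (a b : X) (D : Subgroup (MulAut (FreeGroup X))) :
    Subgroup (MulAut (FreeGroup X)) where
  carrier := {α | ∃ φ ∈ D, ∀ g, φ (conjSubst a b g) = conjSubst a b (α g)}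
  one_mem' := ⟨1, D.one_mem, fun g => rfl⟩
  mul_mem' := by
    rintro α β ⟨φ, hφ, hα⟩ ⟨ψ, hψ, hβ⟩
    exact ⟨φ * ψ, D.mul_mem hφ hψ, fun g => by rw [MulAut.mul_apply, hβ, hα, MulAut.mul_apply]⟩
  inv_mem' := by
    rintro α ⟨φ, hφ, hα⟩
    refine ⟨φ⁻¹, D.inv_mem hφ, fun g => ?_⟩
    rw [MulAut.inv_apply, MulEquiv.symm_apply_eq, hα, MulAut.apply_inv_self]

variable {a b : X} (hab : a ≠ b)

include hab in
theorem exists_hom_extension {f : FreeGroup X →* FreeGroup X} {g h : FreeGroup X}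
    (hfa : f (of a) = g * of a * g⁻¹) (hfb : f (of b) = h⁻¹ * of b * h) :
    ∃ F : FreeGroup X →* FreeGroup X, F (of a) = conjSubst a b g * of a * conjSubst a b h ∧
      ∀ x, F (conjSubst a b x) = conjSubst a b (f x) := by
  let F : FreeGroup X →* FreeGroup X := lift fun i =>
    if i = a then conjSubst a b g * of a * conjSubst a b h else conjSubst a b (f (of i))
  have hFa : F (of a) = conjSubst a b g * of a * conjSubst a b h := by simp [F]
  have hF : ∀ i ≠ a, F (of i) = conjSubst a b (f (of i)) := fun i hi => by simp [F, hi]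
  refine ⟨F, hFa, fun x => ?_⟩
  have : F.comp (conjSubst a b) = (conjSubst a b).comp f := by
    ext i
    by_cases hi : i = a
    · subst hi
      simp only [MonoidHom.comp_apply, conjSubst_of_self, _root_.map_mul, _root_.map_inv, hFa,
        hF b hab.symm, hfa, hfb, conjSubst_of_ne hab.symm]
      group
    · simp [conjSubst_of_ne hi, hF i hi]
  exact DFunLike.congr_fun this x

theorem hom_ext_of_conjSubst {f f' : FreeGroup X →* FreeGroup X} (ha : f (of a) = f' (of a))
    (h : ∀ g, f (conjSubst a b g) = f' (conjSubst a b g)) : f = f' := by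
  ext i
  by_cases hi : i = a
  · rw [hi, ha]
  · have := h (of i)
    rwa [conjSubst_of_ne hi] at this

theorem mulAut_ext_of_conjSubst {φ ψ : MulAut (FreeGroup X)} (ha : φ (of a) = ψ (of a))
    (h : ∀ g, φ (conjSubst a b g) = ψ (conjSubst a b g)) : φ = ψ := by
  have := hom_ext_of_conjSubst (f := φ.toMonoidHom) (f' := ψ.toMonoidHom) ha h
  exact MulEquiv.ext fun g => DFunLike.congr_fun this g

include hab in
theorem exists_mulAut_extension {α : MulAut (FreeGroup X)} {g h : FreeGroup X}
    (ha : α (of a) = g * of a * g⁻¹) (hb : α (of b) = h⁻¹ * of b * h) :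
    ∃ φ : MulAut (FreeGroup X), φ (of a) = conjSubst a b g * of a * conjSubst a b h ∧
      ∀ x, φ (conjSubst a b x) = conjSubst a b (α x) := by
  obtain ⟨F, hFa, hF⟩ := exists_hom_extension hab (f := α.toMonoidHom) ha hb
  obtain ⟨F', hFa', hF'⟩ := exists_hom_extension hab (f := (α⁻¹).toMonoidHom)
    (g := (α⁻¹ g)⁻¹) (h := (α⁻¹ h)⁻¹)
    (by
      have := congrArg (α⁻¹ : MulAut (FreeGroup X)) ha
      simp only [_root_.map_mul, _root_.map_inv, MulAut.inv_apply_self] at this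
      change α⁻¹ (of a) = _
      generalize α⁻¹ (of a) = y at this ⊢
      rw [this]
      group)
    (by
      have := congrArg (α⁻¹ : MulAut (FreeGroup X)) hb
      simp only [_root_.map_mul, _root_.map_inv, MulAut.inv_apply_self] at this
      change α⁻¹ (of b) = _
      generalize α⁻¹ (of b) = y at this ⊢
      rw [this]
      group)
  change ∀ x, F (conjSubst a b x) = conjSubst a b (α x) at hF
  change ∀ x, F' (conjSubst a b x) = conjSubst a b (α⁻¹ x) at hF'
  have h₁ : F.comp F' = MonoidHom.id _ := by
    refine hom_ext_of_conjSubst (a := a) (b := b) ?_ fun x => ?_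
    · simp only [MonoidHom.comp_apply, hFa', _root_.map_mul, _root_.map_inv, hF, hFa,
        MulAut.apply_inv_self, MonoidHom.id_apply]
      group
    · simp only [MonoidHom.comp_apply, hF', hF, MulAut.apply_inv_self, MonoidHom.id_apply]
  have h₂ : F'.comp F = MonoidHom.id _ := by
    refine hom_ext_of_conjSubst (a := a) (b := b) ?_ fun x => ?_
    · simp only [MonoidHom.comp_apply, hFa, _root_.map_mul, _root_.map_inv, hF', hFa',
        MonoidHom.id_apply]
      group
    · simp only [MonoidHom.comp_apply, hF', hF, MulAut.inv_apply_self, MonoidHom.id_apply]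
  exact ⟨MonoidHom.toMulEquiv F F' h₂ h₁, hFa, hF⟩

section

variable {ρ : MulAut (FreeGroup X)} (hρa : ρ (of a) = of a * of b)
  (hρ : ∀ i ≠ a, ρ (of i) = of i)

include hab hρa hρ

theorem mulAut_map_conjSubst (g : FreeGroup X) : ρ (conjSubst a b g) = conjSubst a b g :=
  map_conjSubst hab (ρ := ρ.toMonoidHom) hρa hρ g

theorem mem_centralizer_of_extension {α φ : MulAut (FreeGroup X)} {g h : FreeGroup X}
    (hb : α (of b) = h⁻¹ * of b * h)
    (hφa : φ (of a) = conjSubst a b g * of a * conjSubst a b h)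
    (hφ : ∀ x, φ (conjSubst a b x) = conjSubst a b (α x)) :
    φ ∈ Subgroup.centralizer {ρ} := by
  rw [Subgroup.mem_centralizer_singleton_iff]
  have hρι := mulAut_map_conjSubst hab hρa hρ
  refine mulAut_ext_of_conjSubst (a := a) (b := b) ?_ fun x => ?_
  · have h₁ := hφ (of b)
    rw [conjSubst_of_ne hab.symm, hb] at h₁
    simp only [MulAut.mul_apply, hρa, _root_.map_mul, hφa, h₁, hρι, _root_.map_inv,
      conjSubst_of_ne hab.symm]
    group
  · simp only [MulAut.mul_apply, hρι, hφ]

theorem exists_extension {α : MulAut (FreeGroup X)} {g h : FreeGroup X}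
    (ha : α (of a) = g * of a * g⁻¹) (hb : α (of b) = h⁻¹ * of b * h) :
    ∃ φ ∈ Subgroup.centralizer {ρ}, φ (of a) = conjSubst a b g * of a * conjSubst a b h ∧
      ∀ x, φ (conjSubst a b x) = conjSubst a b (α x) := by
  obtain ⟨φ, hφa, hφ⟩ := exists_mulAut_extension hab ha hb
  exact ⟨φ, mem_centralizer_of_extension hab hρa hρ hb hφa hφ, hφa, hφ⟩

theorem exists_conjSubst_eq {φ : MulAut (FreeGroup X)} (hφ : φ ∈ Subgroup.centralizer {ρ})
    (g : FreeGroup X) : ∃ g', φ (conjSubst a b g) = conjSubst a b g' := by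
  have h₁ : ρ (φ (conjSubst a b g)) = φ (conjSubst a b g) := by
    rw [Subgroup.mem_centralizer_singleton_iff] at hφ
    rw [← MulAut.mul_apply, ← hφ, MulAut.mul_apply, mulAut_map_conjSubst hab hρa hρ]
  obtain ⟨g', hg'⟩ := (mem_range_conjSubst_iff hab (ρ := ρ.toMonoidHom) hρa hρ _).2 h₁
  exact ⟨g', hg'.symm⟩

theorem exists_restriction {φ : MulAut (FreeGroup X)} (hφ : φ ∈ Subgroup.centralizer {ρ}) :
    ∃ α : MulAut (FreeGroup X), ∀ x, φ (conjSubst a b x) = conjSubst a b (α x) := by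
  choose f hf using exists_conjSubst_eq hab hρa hρ hφ
  choose f' hf' using exists_conjSubst_eq hab hρa hρ (inv_mem hφ)
  have hinj := conjSubst_injective hab
  refine ⟨⟨⟨f, f', fun x => hinj ?_, fun x => hinj ?_⟩, fun x y => hinj ?_⟩, hf⟩
  · rw [← hf', ← hf, MulAut.inv_apply_self]
  · rw [← hf, ← hf', MulAut.apply_inv_self]
  · simp only [← hf, _root_.map_mul]

theorem exists_apply_of_eq {φ : MulAut (FreeGroup X)} (hφ : φ ∈ Subgroup.centralizer {ρ}) :
    ∃ g h, φ (of a) = conjSubst a b g * of a * conjSubst a b h ∨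
      φ (of a) = conjSubst a b g * (of a)⁻¹ * conjSubst a b h := by
  obtain ⟨α, hα⟩ := exists_restriction hab hρa hρ hφ
  have h₁ := hα (of b)
  rw [conjSubst_of_ne hab.symm] at h₁
  have h₂ : ρ (φ (of a)) = φ (of a) * conjSubst a b (α (of b)) := by
    rw [Subgroup.mem_centralizer_singleton_iff] at hφ
    rw [← MulAut.mul_apply, ← hφ, MulAut.mul_apply, hρa, _root_.map_mul, h₁]
  rcases exists_of_map_eq_mul_conjSubst hab (ρ := ρ.toMonoidHom) hρa hρ h₂ with
    ⟨h, -⟩ | ⟨g, h, hw, -⟩ | ⟨g, h, hw, -⟩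
  · exact absurd ((map_eq_one_iff α α.injective).1 h) (of_ne_one b)
  · exact ⟨g, h, Or.inl hw⟩
  · exact ⟨g, h, Or.inr hw⟩

theorem restriction_apply_of {φ α : MulAut (FreeGroup X)} (hφ : φ ∈ Subgroup.centralizer {ρ})
    (hα : ∀ x, φ (conjSubst a b x) = conjSubst a b (α x)) {g h : FreeGroup X}
    (ha : φ (of a) = conjSubst a b g * of a * conjSubst a b h) :
    α (of a) = g * of a * g⁻¹ ∧ α (of b) = h⁻¹ * of b * h := by
  have hinj := conjSubst_injective hab
  have hρι := mulAut_map_conjSubst hab hρa hρ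
  have hb : φ (of b) = conjSubst a b (h⁻¹ * of b * h) := by
    rw [Subgroup.mem_centralizer_singleton_iff] at hφ
    have h₁ := DFunLike.congr_fun hφ (of a)
    simp only [MulAut.mul_apply, hρa, _root_.map_mul, ha, hρι] at h₁
    rw [← eq_inv_mul_iff_mul_eq] at h₁
    rw [h₁]
    simp only [_root_.map_mul, _root_.map_inv, conjSubst_of_ne hab.symm]
    group
  constructor
  · apply hinj
    rw [← hα]
    simp only [conjSubst_of_self, _root_.map_mul, _root_.map_inv, ha, hb,
      conjSubst_of_ne hab.symm]
    group
  · apply hinj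
    rw [← hα, conjSubst_of_ne hab.symm, hb]

omit [DecidableEq X] in
theorem zpow_apply_of (k : ℤ) : (ρ ^ k) (of a) = of a * of b ^ k := by
  have hb := hρ b hab.symm
  have hb' : ρ⁻¹ (of b) = of b := by
    conv_lhs => rw [← hb]
    rw [MulAut.inv_apply_self]
  have ha' : ρ⁻¹ (of a) = of a * (of b)⁻¹ := by
    rw [MulAut.inv_apply, MulEquiv.symm_apply_eq, _root_.map_mul, hρa, _root_.map_inv, hb]
    group
  induction k using Int.induction_on with
  | zero => simp
  | succ i ih =>
    rw [add_comm, zpow_add, MulAut.mul_apply, ih, _root_.map_mul, map_zpow, zpow_one, hρa, hb]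
    group
  | pred i ih =>
    rw [sub_eq_neg_add, zpow_add, MulAut.mul_apply, ih, _root_.map_mul, map_zpow, zpow_neg_one,
      ha', hb']
    group

theorem exists_eq_zpow {φ : MulAut (FreeGroup X)}
    (hφ : ∀ x, φ (conjSubst a b x) = conjSubst a b x) : ∃ k : ℤ, φ = ρ ^ k := by
  have hb := hφ (of b)
  have ha := hφ (of a)
  rw [conjSubst_of_ne hab.symm] at hb
  rw [conjSubst_of_self, _root_.map_mul, _root_.map_mul, _root_.map_inv, hb] at ha
  obtain ⟨k, hk⟩ := mem_zpowers_of_commute_of (i := b) (g := (of a)⁻¹ * φ (of a)) (by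
    have : (of a)⁻¹ * φ (of a) * of b * ((of a)⁻¹ * φ (of a))⁻¹ =
      (of a)⁻¹ * (φ (of a) * of b * (φ (of a))⁻¹) * of a := by group
    rw [this, ha]
    group)
  refine ⟨k, mulAut_ext_of_conjSubst (a := a) (b := b) ?_ fun x => ?_⟩
  · rw [zpow_apply_of hab hρa hρ]
    change of b ^ k = _ at hk
    rw [hk, mul_inv_cancel_left]
  · have h₁ : ρ ∈ MulAction.stabilizer (MulAut (FreeGroup X)) (conjSubst a b x) :=
      mulAut_map_conjSubst hab hρa hρ x
    rw [hφ]
    exact (zpow_mem h₁ k : (ρ ^ k) • conjSubst a b x = _).symm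

end

end FreeGroup

namespace FreeGroup

open scoped commutatorElement

variable {X : Type*} [DecidableEq X] {a b : X}

theorem mulAut_inv_conjSubst {φ α : MulAut (FreeGroup X)}
    (h : ∀ x, φ (conjSubst a b x) = conjSubst a b (α x)) (x : FreeGroup X) :
    φ⁻¹ (conjSubst a b x) = conjSubst a b (α⁻¹ x) := by
  rw [MulAut.inv_apply, MulEquiv.symm_apply_eq, h, MulAut.apply_inv_self]

theorem commutator_conjSubst {φ ψ α β : MulAut (FreeGroup X)}
    (hα : ∀ x, φ (conjSubst a b x) = conjSubst a b (α x))
    (hβ : ∀ x, ψ (conjSubst a b x) = conjSubst a b (β x)) (x : FreeGroup X) :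
    ⁅φ, ψ⁆ (conjSubst a b x) = conjSubst a b (⁅α, β⁆ x) := by
  simp only [commutatorElement_def, MulAut.mul_apply, hα, hβ, mulAut_inv_conjSubst hα,
    mulAut_inv_conjSubst hβ]

variable (hab : a ≠ b) {ρ : MulAut (FreeGroup X)} (hρa : ρ (of a) = of a * of b)
  (hρ : ∀ i ≠ a, ρ (of i) = of i)

section

variable {K : Subgroup (MulAut (FreeGroup X))}
  (hcomm : ∀ f ∈ Subgroup.centralizer {ρ}, ∀ g ∈ Subgroup.centralizer {ρ}, ⁅f, g⁆ ∈ K)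

theorem commutatorElement_mem {G : Type*} [Group G] {H : Subgroup G} {g h : G} (hg : g ∈ H)
    (hh : h ∈ H) : ⁅g, h⁆ ∈ H :=
  mul_mem (mul_mem (mul_mem hg hh) (inv_mem hg)) (inv_mem hh)

include hab hρa hρ hcomm

theorem commutator_mem_inducedMulAut {α β : MulAut (FreeGroup X)}
    (hα : ∀ j ∈ ({a, b} : Set X), IsConj (of j) (α (of j)))
    (hβ : ∀ j ∈ ({a, b} : Set X), IsConj (of j) (β (of j))) :
    ⁅α, β⁆ ∈ inducedMulAut a b (K ⊓ Subgroup.centralizer {ρ}) := by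
  have lift : ∀ α : MulAut (FreeGroup X), (∀ j ∈ ({a, b} : Set X), IsConj (of j) (α (of j))) →
      ∃ φ ∈ Subgroup.centralizer {ρ}, ∀ x, φ (conjSubst a b x) = conjSubst a b (α x) := by
    intro α hα
    obtain ⟨g, hg⟩ := isConj_iff.1 (hα a (by simp))
    obtain ⟨h, hh⟩ := isConj_iff.1 (hα b (by simp))
    obtain ⟨φ, hφ, -, hφα⟩ := exists_extension hab hρa hρ (g := g) (h := h⁻¹) hg.symm
      (by rw [inv_inv]; exact hh.symm)
    exact ⟨φ, hφ, hφα⟩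
  obtain ⟨φ, hφ, hφα⟩ := lift α hα
  obtain ⟨ψ, hψ, hψβ⟩ := lift β hβ
  exact ⟨⁅φ, ψ⁆, ⟨hcomm φ hφ ψ hψ, commutatorElement_mem hφ hψ⟩,
    commutator_conjSubst hφα hψβ⟩

theorem exists_conj_mem_inf_centralizer {c k : X} (hca : c ≠ a) (hcb : c ≠ b) (hka : k ≠ a) (hkb : k ≠ b)
    (hkc : k ≠ c) :
    ∃ ω ∈ K ⊓ Subgroup.centralizer {ρ}, ω (of c) = of b * of c * (of b)⁻¹ ∧
      ∀ i ≠ c, ω (of i) = of i := by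
  set D₀ : Subgroup (MulAut (FreeGroup X)) := K ⊓ Subgroup.centralizer {ρ} ⊓
    MulAction.stabilizer (MulAut (FreeGroup X)) (of a) with hD₀
  have lift : ∀ α : MulAut (FreeGroup X), (∀ j ∈ ({a, b} : Set X), α (of j) = of j) →
      ∃ φ ∈ Subgroup.centralizer {ρ} ⊓ MulAction.stabilizer (MulAut (FreeGroup X)) (of a),
        ∀ x, φ (conjSubst a b x) = conjSubst a b (α x) := by
    intro α hα
    obtain ⟨φ, hφ, hφa, hφα⟩ := exists_extension hab hρa hρ (α := α) (g := 1) (h := 1)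
      (by simpa using hα a (by simp)) (by simpa using hα b (by simp))
    exact ⟨φ, ⟨hφ, by simpa using hφa⟩, hφα⟩
  have hS : ∀ α β : MulAut (FreeGroup X), (∀ j ∈ ({a, b} : Set X), α (of j) = of j) →
      (∀ j ∈ ({a, b} : Set X), β (of j) = of j) → ⁅α, β⁆ ∈ inducedMulAut a b D₀ := by
    intro α β hα hβ
    obtain ⟨φ, hφ, hφα⟩ := lift α hα
    obtain ⟨ψ, hψ, hψβ⟩ := lift β hβ
    have h₁ := commutatorElement_mem hφ hψ
    exact ⟨⁅φ, ψ⁆, ⟨⟨hcomm φ hφ.1 ψ hψ.1, h₁.1⟩, h₁.2⟩, commutator_conjSubst hφα hψβ⟩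
  have hcT : c ∉ ({a, b} : Set X) := by simp [hca, hcb]
  have hkT : k ∉ ({a, b} : Set X) := by simp [hka, hkb]
  obtain ⟨σ₁, hσ₁, h₁, h₁'⟩ :=
    exists_mul_right_mem hS hcT hkT hkc (d := (b, false)) hcb.symm hkb.symm
  obtain ⟨σ₂, hσ₂, h₂, h₂'⟩ :=
    exists_mul_left_mem hS hcT hkT hkc (d := (b, true)) hcb.symm hkb.symm
  change _ = of c * (of b)⁻¹ at h₁
  change _ = of b * of c at h₂
  obtain ⟨ω, ⟨hω, hωa⟩, hωι⟩ := mul_mem hσ₁ hσ₂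
  change ω (of a) = of a at hωa
  refine ⟨ω, hω, ?_, fun i hi => ?_⟩
  · have := hωι (of c)
    rw [conjSubst_of_ne hca] at this
    rw [this, MulAut.mul_apply, h₂, _root_.map_mul, h₁, h₁' b hcb.symm]
    simp [conjSubst_of_ne hca, conjSubst_of_ne hab.symm, mul_assoc]
  · by_cases hia : i = a
    · rw [hia, hωa]
    · have := hωι (of i)
      rw [conjSubst_of_ne hia] at this
      rw [this, MulAut.mul_apply, h₂' i hi, h₁' i hi, conjSubst_of_ne hia]

theorem mem_of_commutator_mem {c k : X} (hca : c ≠ a) (hcb : c ≠ b) (hka : k ≠ a) (hkb : k ≠ b)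
    (hkc : k ≠ c) : ρ ∈ K := by
  obtain ⟨ω, ⟨hωK, hωC⟩, hω, hω'⟩ := exists_conj_mem_inf_centralizer hab hρa hρ hcomm hca hcb hka hkb hkc
  have hcb' : of c ∈ Subgroup.closure (of '' ({b}ᶜ : Set X)) := of_mem_closure hcb
  have hbc' : of b ∈ Subgroup.closure (of '' ({c}ᶜ : Set X)) := of_mem_closure hcb.symm
  obtain ⟨α, hα, hα'⟩ := exists_mulAut_mul b hcb' (inv_mem hcb')
  obtain ⟨β, hβ, hβ'⟩ := exists_mulAut_mul c (one_mem _) hbc'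
  obtain ⟨κ, hκC, hκa, hκ⟩ := exists_extension hab hρa hρ (α := α) (g := 1) (h := (of c)⁻¹)
    (by simp [hα' a hab]) (by rw [hα, inv_inv])
  obtain ⟨η, hηC, hηa, hη⟩ := exists_extension hab hρa hρ (α := β) (g := 1) (h := 1)
    (by simp [hβ' a hca.symm]) (by simp [hβ' b hcb.symm])
  have hκi : ∀ i ≠ a, κ (of i) = conjSubst a b (α (of i)) := fun i hi => by
    rw [← hκ, conjSubst_of_ne hi]
  have hηi : ∀ i ≠ a, η (of i) = conjSubst a b (β (of i)) := fun i hi => by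
    rw [← hη, conjSubst_of_ne hi]
  have hι := fun i (hi : i ≠ a) => conjSubst_of_ne (b := b) hi
  have hκb := hκi b hab.symm
  have hκc := hκi c hca
  have hηb := hηi b hab.symm
  have hηc := hηi c hca
  simp only [hα, hα' c hcb, hβ, hβ' b hcb.symm, _root_.map_mul, _root_.map_inv, hι c hca,
    hι b hab.symm, _root_.map_one, one_mul] at hκa hηa hκb hκc hηb hηc
  rw [mul_one] at hηa
  have key : ρ * η * κ = κ * ω * η := by
    refine mulAut_ext fun i => ?_
    simp only [MulAut.mul_apply]
    by_cases hia : i = a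
    · subst hia
      simp [hκa, hηa, hω' i hca.symm, hηc, hρa, hρ b hab.symm, hρ c hca]
    by_cases hib : i = b
    · subst hib
      simp [hκb, hηb, hω' i hcb.symm, hηc, hρ i hia, hρ c hca, mul_assoc]
    by_cases hic : i = c
    · subst hic
      simp [hκc, hηc, hω, hω' b (Ne.symm hib), hρ i hia, hρ b hab.symm, hκb]
    · have e₁ : κ (of i) = of i := by rw [hκi i hia, hα' i hib, hι i hia]
      have e₂ : η (of i) = of i := by rw [hηi i hia, hβ' i hic, hι i hia]
      rw [e₁, e₂, hρ i hia, hω' i hic, e₁]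
  have : ρ = ⁅κ, ω⁆ * ω * ⁅κ, η⁆ := by
    have : ρ = κ * ω * η * κ⁻¹ * η⁻¹ := by rw [← key]; group
    rw [this, commutatorElement_def, commutatorElement_def]
    group
  rw [this]
  exact mul_mem (mul_mem (hcomm _ hκC _ hωC) hωK) (hcomm _ hκC _ hηC)

theorem centralizer_le [Fintype X] (hT : ∀ i j, ∃ k ∉ ({a, b} : Set X), k ≠ i ∧ k ≠ j)
    {τ : MulAut (FreeGroup X)} (hτ : τ ∈ K ⊓ Subgroup.centralizer {ρ}) (hτa : τ (of a) = (of a)⁻¹)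
    {s : MulAut (FreeGroup X)} (hs : s ∈ K ⊓ Subgroup.centralizer {ρ}) {c : X} (hca : c ≠ a)
    (hcb : c ≠ b) (hsc : s (of c) = (of c)⁻¹) (hs' : ∀ i ≠ c, s (of i) = of i) :
    Subgroup.centralizer {ρ} ≤ K := by
  obtain ⟨k, hkT, hkc, -⟩ := hT c c
  obtain ⟨hka, hkb⟩ : k ≠ a ∧ k ≠ b := by simpa using hkT
  have hρK := mem_of_commutator_mem hab hρa hρ hcomm hca hcb hka hkb hkc
  obtain ⟨s', hs'c, hs'i⟩ := exists_mulAut_inv c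
  have hss' : s' ∈ inducedMulAut a b (K ⊓ Subgroup.centralizer {ρ}) := by
    refine ⟨s, hs, fun x => ?_⟩
    have : s.toMonoidHom.comp (conjSubst a b) = (conjSubst a b).comp s'.toMonoidHom := by
      ext i
      change s (conjSubst a b (of i)) = conjSubst a b (s' (of i))
      by_cases hia : i = a
      · subst hia
        simp [hs'i i hca.symm, hs' i hca.symm, hs' b hcb.symm]
      by_cases hic : i = c
      · subst hic
        simp [conjSubst_of_ne hia, hsc, hs'c]
      · simp [conjSubst_of_ne hia, hs' i hic, hs'i i hic]
    exact DFunLike.congr_fun this x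
  have plus : ∀ φ ∈ Subgroup.centralizer {ρ}, ∀ g h,
      φ (of a) = conjSubst a b g * of a * conjSubst a b h → φ ∈ K := by
    intro φ hφ g h hφa
    obtain ⟨α, hα⟩ := exists_restriction hab hρa hρ hφ
    obtain ⟨h₁, h₂⟩ := restriction_apply_of hab hρa hρ hφ hα hφa
    obtain ⟨ψ, hψ, hψα⟩ := mem_of_isConj_of_commutator
      (S := inducedMulAut a b (K ⊓ Subgroup.centralizer {ρ}))
      (fun α β => commutator_mem_inducedMulAut hab hρa hρ hcomm) hT
      ⟨c, by simp [hca, hcb], s', hss', hs'c, hs'i⟩ (α := α) (by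
        rintro j (rfl | rfl)
        · exact isConj_iff.2 ⟨g, h₁.symm⟩
        · exact isConj_iff.2 ⟨h⁻¹, by rw [h₂, inv_inv]⟩)
    obtain ⟨n, hn⟩ := exists_eq_zpow hab hρa hρ (φ := ψ⁻¹ * φ) fun x => by
      rw [MulAut.mul_apply, hα, mulAut_inv_conjSubst hψα, MulAut.inv_apply_self]
    rw [inv_mul_eq_iff_eq_mul] at hn
    rw [hn]
    exact mul_mem hψ.1 (zpow_mem hρK n)
  intro φ hφ
  obtain ⟨g, h, hφa | hφa⟩ := exists_apply_of_eq hab hρa hρ hφ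
  · exact plus φ hφ g h hφa
  · have := plus (φ * τ) (mul_mem hφ hτ.2) h⁻¹ g⁻¹ (by
      rw [MulAut.mul_apply, hτa, _root_.map_inv, hφa, _root_.map_inv, _root_.map_inv]
      group)
    exact (K.mul_mem_cancel_right hτ.1).1 this

end

end FreeGroup

theorem abelianization_mulEquiv_of_generators {C : Type*} [Group C] {s t : C} (hs : s * s = 1)
    (ht : t * t = 1) (f : C →* ℤˣ × ℤˣ) (hfs : f s = (-1, 1)) (hft : f t = (1, -1))
    (hgen : ∀ K : Subgroup C, commutator C ≤ K → s ∈ K → t ∈ K → K = ⊤) :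
    Nonempty (Abelianization C ≃* Multiplicative (ZMod 2 × ZMod 2)) := by
  let F := Abelianization.lift f
  have hFs : F (Abelianization.of s) = (-1, 1) := by rw [Abelianization.lift_apply_of, hfs]
  have hFt : F (Abelianization.of t) = (1, -1) := by rw [Abelianization.lift_apply_of, hft]
  have hs' : Abelianization.of s * Abelianization.of s = 1 := by rw [← map_mul, hs, map_one]
  have ht' : Abelianization.of t * Abelianization.of t = 1 := by rw [← map_mul, ht, map_one]
  have hzpow : ∀ {z : Abelianization C}, z * z = 1 → ∀ n : ℤ, Even n → z ^ n = 1 := by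
    rintro z hz _ ⟨n, rfl⟩
    rw [zpow_add, ← mul_zpow, hz, one_zpow]
  have hunit : ∀ n : ℤ, (-1 : ℤˣ) ^ n = 1 → Even n := fun n hn => by
    by_contra h
    rw [Int.not_even_iff_odd] at h
    rw [h.neg_one_zpow] at hn
    exact absurd hn (by decide)
  have hinj : Function.Injective F := by
    refine (injective_iff_map_eq_one F).2 fun z hz => ?_
    have hmem : z ∈ Subgroup.closure {Abelianization.of s, Abelianization.of t} := by
      obtain ⟨x, rfl⟩ := QuotientGroup.mk_surjective z
      have := hgen ((Subgroup.closure {Abelianization.of s, Abelianization.of t}).comap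
        Abelianization.of) ?_ (Subgroup.subset_closure (by simp))
        (Subgroup.subset_closure (by simp))
      · exact this.ge (Subgroup.mem_top x)
      · rw [← Abelianization.ker_of]
        exact MonoidHom.ker_le_comap _ _
    obtain ⟨m, n, rfl⟩ := Subgroup.mem_closure_pair.1 hmem
    rw [map_mul, map_zpow, map_zpow, hFs, hFt] at hz
    simp only [Prod.pow_mk, Prod.mk_mul_mk, one_zpow, mul_one, one_mul, Prod.mk_eq_one] at hz
    rw [hzpow hs' m (hunit m hz.1), hzpow ht' n (hunit n hz.2), mul_one]
  have hsurj : Function.Surjective F := by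
    rintro ⟨u, v⟩
    rcases Int.units_eq_one_or u with rfl | rfl <;> rcases Int.units_eq_one_or v with rfl | rfl
    · exact ⟨1, map_one F⟩
    · exact ⟨_, hFt⟩
    · exact ⟨_, hFs⟩
    · exact ⟨Abelianization.of s * Abelianization.of t, by rw [map_mul, hFs, hFt]; rfl⟩
  have e : ℤˣ ≃* Multiplicative (ZMod 2) :=
    mulEquivOfPrimeCardEq (p := 2) (by simp) (by simp)
  exact ⟨(MulEquiv.ofBijective F ⟨hinj, hsurj⟩).trans
    ((e.prodCongr e).trans (MulEquiv.prodMultiplicative _ _).symm)⟩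

namespace FreeGroup

variable {X : Type*} [DecidableEq X]

/-- The vector of exponent sums of a word. -/
def exponentSum : FreeGroup X →* Multiplicative (X → ℤ) :=
  lift fun i => Multiplicative.ofAdd (Pi.single i 1)

theorem exponentSum_of (i : X) :
    exponentSum (of i) = Multiplicative.ofAdd (Pi.single i (1 : ℤ)) := lift_apply_of

section

variable [Fintype X]

/-- The matrix of an endomorphism of a free group on exponent sums. -/
def exponentMatrix (φ : FreeGroup X →* FreeGroup X) : Matrix X X ℤ :=
  Matrix.of fun i j => (exponentSum (φ (of j))).toAdd i

theorem exponentMatrix_mulVec (φ : FreeGroup X →* FreeGroup X) (g : FreeGroup X) :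
    Matrix.mulVec (exponentMatrix φ) (exponentSum g).toAdd = (exponentSum (φ g)).toAdd := by
  have : (AddMonoidHom.toMultiplicative (Matrix.mulVecLin (exponentMatrix φ)).toAddMonoidHom).comp
      exponentSum = exponentSum.comp φ := by
    ext i : 1
    simp only [MonoidHom.comp_apply, exponentSum_of]
    refine Multiplicative.toAdd.injective ?_
    change Matrix.mulVec (exponentMatrix φ) (Pi.single i 1) = _
    rw [Matrix.mulVec_single_one]
    rfl
  exact congrArg Multiplicative.toAdd (DFunLike.congr_fun this g)

theorem exponentMatrix_comp (φ ψ : FreeGroup X →* FreeGroup X) :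
    exponentMatrix (φ.comp ψ) = exponentMatrix φ * exponentMatrix ψ := by
  ext i j
  exact (congrFun (exponentMatrix_mulVec φ (ψ (of j))) i).symm

omit [Fintype X] in
theorem exponentMatrix_id : exponentMatrix (MonoidHom.id (FreeGroup X)) = 1 := by
  ext i j
  simp [exponentMatrix, exponentSum_of, Matrix.one_apply, Pi.single_apply]

/-- The determinant of the action of an automorphism on exponent sums. -/
def exponentDet : MulAut (FreeGroup X) →* ℤ where
  toFun φ := (exponentMatrix φ.toMonoidHom).det
  map_one' := by
    change (exponentMatrix (MonoidHom.id _)).det = 1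
    rw [exponentMatrix_id, Matrix.det_one]
  map_mul' φ ψ := by
    rw [← Matrix.det_mul, ← exponentMatrix_comp]
    rfl

theorem exponentDet_eq_prod {φ : MulAut (FreeGroup X)} {d : X → ℤ}
    (h : ∀ i, exponentSum (φ (of i)) = exponentSum (of i) ^ d i) :
    exponentDet φ = ∏ i, d i := by
  have : exponentMatrix φ.toMonoidHom = Matrix.diagonal d := by
    ext i j
    change (exponentSum (φ (of j))).toAdd i = _
    rw [h, exponentSum_of, toAdd_zpow, toAdd_ofAdd, Pi.smul_apply, Pi.single_apply,
      Matrix.diagonal_apply]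
    split_ifs with hij
    · simp [hij]
    · simp
  change (exponentMatrix φ.toMonoidHom).det = _
  rw [this, Matrix.det_diagonal]

end

variable {a b : X} (hab : a ≠ b) {ρ : MulAut (FreeGroup X)} (hρa : ρ (of a) = of a * of b)
  (hρ : ∀ i ≠ a, ρ (of i) = of i)

section

include hρa hρ

theorem exponentSum_apply (g : FreeGroup X) :
    exponentSum (ρ g) = exponentSum g * exponentSum (of b) ^ (exponentSum g).toAdd a := by
  let f : FreeGroup X →* Multiplicative (X → ℤ) :=
    { toFun := fun g => exponentSum g * exponentSum (of b) ^ (exponentSum g).toAdd a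
      map_one' := by simp
      map_mul' := fun g h => by
        rw [_root_.map_mul, toAdd_mul, Pi.add_apply, zpow_add, mul_mul_mul_comm] }
  have : exponentSum.comp ρ.toMonoidHom = f := by
    ext i : 1
    change exponentSum (ρ (of i)) =
      exponentSum (of i) * exponentSum (of b) ^ (exponentSum (of i)).toAdd a
    by_cases hi : i = a
    · subst hi
      simp [hρa, exponentSum_of]
    · simp [hρ i hi, exponentSum_of i, Ne.symm hi]
  exact DFunLike.congr_fun this g

theorem exponentSum_apply_eq_zpow {φ : MulAut (FreeGroup X)}
    (hφ : φ ∈ Subgroup.centralizer {ρ}) :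
    exponentSum (φ (of b)) = exponentSum (of b) ^ (exponentSum (φ (of b))).toAdd b := by
  have h₁ : exponentSum (φ (of b)) = exponentSum (of b) ^ (exponentSum (φ (of a))).toAdd a := by
    rw [Subgroup.mem_centralizer_singleton_iff] at hφ
    have h := congrArg exponentSum (DFunLike.congr_fun hφ (of a))
    rw [MulAut.mul_apply, MulAut.mul_apply, hρa, exponentSum_apply hρa hρ, _root_.map_mul,
      _root_.map_mul] at h
    exact mul_left_cancel h
  have h₂ : (exponentSum (φ (of b))).toAdd b = (exponentSum (φ (of a))).toAdd a := by
    rw [h₁, exponentSum_of, toAdd_zpow, toAdd_ofAdd, Pi.smul_apply, Pi.single_eq_same]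
    simp
  rw [h₂, ← h₁]

/-- The exponent sum of `b` in the image of `b`, as a homomorphism on the centralizer of `ρ`. -/
def exponentEigenvalue [Fintype X] : Subgroup.centralizer {ρ} →* ℤ where
  toFun φ := (exponentSum (φ.1 (of b))).toAdd b
  map_one' := by simp [exponentSum_of]
  map_mul' φ ψ := by
    have h := exponentMatrix_mulVec φ.1.toMonoidHom (ψ.1 (of b))
    rw [exponentSum_apply_eq_zpow hρa hρ ψ.2, toAdd_zpow, Matrix.mulVec_smul,
      exponentMatrix_mulVec] at h
    have h' := congrFun h b
    rw [mul_comm]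
    exact h'.symm

end

include hab in
theorem exists_mulAut_conj_inv : ∃ τ : MulAut (FreeGroup X), τ * τ = 1 ∧ τ (of a) = (of a)⁻¹ ∧
    τ (of b) = of a * (of b)⁻¹ * (of a)⁻¹ ∧ ∀ i, i ≠ a → i ≠ b → τ (of i) = of i := by
  let f : FreeGroup X →* FreeGroup X := lift fun i =>
    if i = a then (of a)⁻¹ else if i = b then of a * (of b)⁻¹ * (of a)⁻¹ else of i
  have ha : f (of a) = (of a)⁻¹ := by simp [f]
  have hb : f (of b) = of a * (of b)⁻¹ * (of a)⁻¹ := by simp [f, hab.symm]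
  have hi : ∀ i, i ≠ a → i ≠ b → f (of i) = of i := fun i h₁ h₂ => by simp [f, h₁, h₂]
  have hff : f.comp f = MonoidHom.id _ := by
    ext i
    rw [MonoidHom.comp_apply, MonoidHom.id_apply]
    by_cases h₁ : i = a
    · rw [h₁, ha, _root_.map_inv, ha, inv_inv]
    by_cases h₂ : i = b
    · simp only [h₂, hb, ha, _root_.map_mul, _root_.map_inv]
      group
    · rw [hi i h₁ h₂, hi i h₁ h₂]
  exact ⟨MonoidHom.toMulEquiv f f hff hff, MulEquiv.ext fun x => DFunLike.congr_fun hff x,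
    ha, hb, hi⟩

include hab hρa hρ in
theorem nonempty_abelianization_centralizer_mulEquiv [Fintype X]
    (hT : ∀ i j, ∃ k ∉ ({a, b} : Set X), k ≠ i ∧ k ≠ j) :
    Nonempty (Abelianization (Subgroup.centralizer {ρ}) ≃* Multiplicative (ZMod 2 × ZMod 2)) := by
  obtain ⟨c, hc, -⟩ := hT a b
  obtain ⟨hca, hcb⟩ : c ≠ a ∧ c ≠ b := by simpa using hc
  obtain ⟨τ, hττ, hτa, hτb, hτ⟩ := exists_mulAut_conj_inv hab
  obtain ⟨s, hsc, hs⟩ := exists_mulAut_inv c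
  have hss : s * s = 1 := mulAut_ext fun i => by
    by_cases hi : i = c
    · simp [hi, hsc]
    · simp [hs i hi]
  have hτC : τ ∈ Subgroup.centralizer {ρ} := by
    rw [Subgroup.mem_centralizer_singleton_iff]
    refine mulAut_ext fun i => ?_
    simp only [MulAut.mul_apply]
    by_cases h₁ : i = a
    · simp [h₁, hτa, hρa, hτb, mul_assoc]
    by_cases h₂ : i = b
    · simp [h₂, hτb, hρa, hρ b hab.symm, mul_assoc]
    · simp [hτ i h₁ h₂, hρ i h₁]
  have hsC : s ∈ Subgroup.centralizer {ρ} := by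
    rw [Subgroup.mem_centralizer_singleton_iff]
    refine mulAut_ext fun i => ?_
    simp only [MulAut.mul_apply]
    by_cases h₁ : i = a
    · simp [h₁, hρa, hs a hca.symm, hs b hcb.symm]
    by_cases h₂ : i = c
    · simp [h₂, hsc, hρ c hca]
    · simp [hs i h₂, hρ i h₁]
  refine abelianization_mulEquiv_of_generators (s := ⟨s, hsC⟩) (t := ⟨τ, hτC⟩)
    (Subtype.ext hss) (Subtype.ext hττ)
    (((exponentDet.comp (Subgroup.centralizer {ρ}).subtype).toHomUnits).prod
      (exponentEigenvalue hρa hρ).toHomUnits) ?_ ?_ fun K hK hsK hτK => ?_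
  · refine Prod.ext (Units.ext ?_) (Units.ext ?_)
    · change exponentDet s = -1
      rw [exponentDet_eq_prod (d := Function.update 1 c (-1))]
      · simp [Finset.prod_update_of_mem]
      · intro i
        by_cases hi : i = c
        · simp [hi, hsc]
        · simp [hs i hi, hi]
    · change (exponentSum (s (of b))).toAdd b = 1
      simp [hs b hcb.symm, exponentSum_of]
  · refine Prod.ext (Units.ext ?_) (Units.ext ?_)
    · change exponentDet τ = 1
      rw [exponentDet_eq_prod (d := Function.update (Function.update 1 a (-1)) b (-1))]
      · rw [Finset.prod_update_of_mem (Finset.mem_univ b),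
          Finset.prod_update_of_mem (by simpa using hab)]
        simp
      · intro i
        by_cases h₂ : i = b
        · simp [h₂, hτb]
        by_cases h₁ : i = a
        · simp [h₁, hτa, hab]
        · simp [hτ i h₁ h₂, h₁, h₂]
    · change (exponentSum (τ (of b))).toAdd b = -1
      simp [hτb, exponentSum_of]
  · have h := centralizer_le hab hρa hρ (K := K.map (Subgroup.centralizer {ρ}).subtype)
      (fun f hf g hg => ⟨_, hK (Subgroup.commutator_mem_commutator
        (Subgroup.mem_top ⟨f, hf⟩) (Subgroup.mem_top ⟨g, hg⟩)), rfl⟩) hT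
      ⟨⟨_, hτK, rfl⟩, hτC⟩ hτa ⟨⟨_, hsK, rfl⟩, hsC⟩ hca hcb hsc hs
    refine (Subgroup.eq_top_iff' K).2 fun x => ?_
    obtain ⟨y, hy, hyx⟩ := h x.2
    rwa [← Subtype.ext hyx]

end FreeGroup

/-- for every `n ≥ 5` (written as `n = m + 5`; the free group has basis
`{a, b, c₁, …, c_{n-2}}` with `a = of 0`, `b = of 1`, `cᵢ = of (i+1)`), the
abelianization of the centralizer of the Nielsen automorphism
`ρ : a ↦ ab, b ↦ b, cᵢ ↦ cᵢ` is isomorphic to `(ℤ/2ℤ)²`. -/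
theorem nielsen_centralizer_abelianization_ge5
    (m : ℕ)
    (ρ : MulAut (FreeGroup (Fin (m + 5))))
    (hρa : ρ (FreeGroup.of 0) = FreeGroup.of 0 * FreeGroup.of 1)
    (hρ : ∀ i : Fin (m + 5), i ≠ 0 → ρ (FreeGroup.of i) = FreeGroup.of i) :
    Nonempty (Abelianization (Subgroup.centralizer {ρ}) ≃*
      Multiplicative (ZMod 2 × ZMod 2)) := by
  refine FreeGroup.nonempty_abelianization_centralizer_mulEquiv (a := 0) (b := 1) (by simp)
    hρa hρ fun i j => ?_
  obtain ⟨k, hk⟩ := Finset.exists_mem_notMem_of_card_lt_card (s := {0, 1, i, j})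
    (t := (Finset.univ : Finset (Fin (m + 5))))
    (Finset.card_le_four.trans_lt (by rw [Finset.card_univ, Fintype.card_fin]; omega))
  simp only [Finset.mem_insert, Finset.mem_singleton, not_or] at hk
  exact ⟨k, by simp [hk.2.1, hk.2.2.1], hk.2.2.2.1, hk.2.2.2.2⟩
end

section
/- For every integer n ≥ 4, the Nielsen automorphism ρ lies in the commutator subgroup of its centralizer C(ρ) in Aut(F_n); equivalently, ⟦ρ⟧ is the trivial element of H₁(C(ρ)). -/
/-- Any group element lies in the centralizer of the singleton consisting of itself. -/
theorem mem_centralizer_self {G : Type*} [Group G] (g : G) :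
    g ∈ Subgroup.centralizer {g} := by
  rw [Subgroup.mem_centralizer_iff]
  rintro h hh
  rw [Set.mem_singleton_iff] at hh
  rw [hh]

open FreeGroup in
/-- Substitutions `f` and `g` of the basis that are inverse to each other, with `f` compatible
with `ρ`, define an element of the centralizer of `ρ`. -/
theorem exists_centralizer_of_lift {α : Type*} (ρ : MulAut (FreeGroup α))
    (f g : α → FreeGroup α) (hfg : ∀ i, lift f (g i) = of i) (hgf : ∀ i, lift g (f i) = of i)
    (hρf : ∀ i, lift f (ρ (of i)) = ρ (f i)) :
    ∃ φ : Subgroup.centralizer {ρ}, ∀ i, φ.1 (of i) = f i := by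
  have h₁ : (lift g).comp (lift f) = MonoidHom.id _ := FreeGroup.ext_hom _ _ (by simpa using hgf)
  have h₂ : (lift f).comp (lift g) = MonoidHom.id _ := FreeGroup.ext_hom _ _ (by simpa using hfg)
  have h₃ : (lift f).comp ρ.toMonoidHom = ρ.toMonoidHom.comp (lift f) :=
    FreeGroup.ext_hom _ _ (by simpa using hρf)
  refine ⟨⟨(lift f).toMulEquiv (lift g) h₁ h₂, ?_⟩, fun i => by simp⟩
  rw [Subgroup.mem_centralizer_singleton_iff]
  ext x
  exact DFunLike.congr_fun h₃ x

open FreeGroup in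
/-- Elements of the centralizer that agree on the basis are equal. -/
theorem centralizer_ext_of {α : Type*} {ρ : MulAut (FreeGroup α)}
    {φ ψ : Subgroup.centralizer {ρ}} (h : ∀ i, φ.1 (of i) = ψ.1 (of i)) : φ = ψ := by
  refine Subtype.ext (MulEquiv.ext fun x => ?_)
  have : φ.1.toMonoidHom = ψ.1.toMonoidHom := FreeGroup.ext_hom _ _ h
  exact DFunLike.congr_fun this x

/-- Relations which force `x` to become trivial in the abelianization. -/
theorem abelianization_of_eq_one_of_relations {G : Type*} [Group G] {t s r j k i i' u u' x : G}
    (hr : t * r * s = s * t) (hk : k * (r * (j * r)) = j) (hi : r * i = i * i' * r)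
    (hu : r * u = u' * u * r) (hx : i' = x * u' * k) : Abelianization.of x = 1 := by
  replace hr := congrArg Abelianization.of hr
  replace hk := congrArg Abelianization.of hk
  replace hi := congrArg Abelianization.of hi
  replace hu := congrArg Abelianization.of hu
  replace hx := congrArg Abelianization.of hx
  simp only [map_mul] at hr hk hi hu hx
  rw [mul_right_comm, mul_comm (Abelianization.of s), mul_eq_left] at hr
  rw [hr, one_mul, mul_one, mul_eq_right] at hk
  rw [hr, one_mul, mul_one, left_eq_mul] at hi
  rw [hr, one_mul, mul_one, right_eq_mul] at hu
  rw [hk, hi, hu, mul_one, mul_one] at hx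
  exact hx.symm

set_option linter.unusedSimpArgs false in
open FreeGroup in
/-- The automorphism `a ↦ ab` of a free group with at least two further basis elements `c`, `d`
lies in the commutator subgroup of its centralizer. -/
theorem abelianization_of_nielsen {α : Type*} {a b c d : α} (hab : a ≠ b) (hac : a ≠ c)
    (had : a ≠ d) (hbc : b ≠ c) (hbd : b ≠ d) (hcd : c ≠ d) (ρ : MulAut (FreeGroup α))
    (hρa : ρ (of a) = of a * of b) (hρ : ∀ i, i ≠ a → ρ (of i) = of i) :
    Abelianization.of (⟨ρ, mem_centralizer_self ρ⟩ : Subgroup.centralizer {ρ}) = 1 := by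
  classical
  have hρb := hρ b hab.symm
  have hρc := hρ c hac.symm
  have hρd := hρ d had.symm
  have key (f g : α → FreeGroup α) (hf : ∀ i, i ≠ a → i ≠ b → i ≠ c → i ≠ d → f i = of i)
      (hg : ∀ i, i ≠ a → i ≠ b → i ≠ c → i ≠ d → g i = of i)
      (h : ∀ i ∈ [a, b, c, d], lift f (g i) = of i ∧ lift g (f i) = of i ∧
        lift f (ρ (of i)) = ρ (f i)) :
      ∃ φ : Subgroup.centralizer {ρ}, ∀ i, φ.1 (of i) = f i := by
    have h' (i) : lift f (g i) = of i ∧ lift g (f i) = of i ∧ lift f (ρ (of i)) = ρ (f i) := by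
      by_cases hi : i ∈ [a, b, c, d]
      · exact h i hi
      · simp only [List.mem_cons, List.not_mem_nil, or_false, not_or] at hi
        obtain ⟨ha, hb, hc, hd⟩ := hi
        simp [hf i ha hb hc hd, hg i ha hb hc hd, hρ i ha]
    exact exists_centralizer_of_lift ρ f g (fun i => (h' i).1) (fun i => (h' i).2.1)
      fun i => (h' i).2.2
  have ext4 {φ ψ : Subgroup.centralizer {ρ}}
      (h : ∀ i, i ≠ a → i ≠ b → i ≠ c → i ≠ d → φ.1 (of i) = ψ.1 (of i))
      (h' : ∀ i ∈ [a, b, c, d], φ.1 (of i) = ψ.1 (of i)) : φ = ψ := by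
    refine centralizer_ext_of fun i => ?_
    by_cases hi : i ∈ [a, b, c, d]
    · exact h' i hi
    · simp only [List.mem_cons, List.not_mem_nil, or_false, not_or] at hi
      exact h i hi.1 hi.2.1 hi.2.2.1 hi.2.2.2
  have hba := hab.symm
  have hca := hac.symm
  have hda := had.symm
  have hcb := hbc.symm
  have hdb := hbd.symm
  have hdc := hcd.symm
  obtain ⟨T, hT⟩ := key
    (fun i => if i = c then of c * of d else of i)
    (fun i => if i = c then of c * (of d)⁻¹ else of i)
    (by simp +contextual) (by simp +contextual) (by
      simp [hρa, hρb, hρc, hρd, hab, hac, had, hbc, hbd, hcd, hba, hca,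
        hda, hcb, hdb, hdc, mul_assoc])
  obtain ⟨S, hS⟩ := key
    (fun i => if i = d then of d * (of a * of b * (of a)⁻¹) else of i)
    (fun i => if i = d then of d * (of a * of b * (of a)⁻¹)⁻¹ else of i)
    (by simp +contextual) (by simp +contextual) (by
      simp [hρa, hρb, hρc, hρd, hab, hac, had, hbc, hbd, hcd, hba, hca,
        hda, hcb, hdb, hdc, mul_assoc])
  obtain ⟨R, hR⟩ := key
    (fun i => if i = c then of c * (of a * of b * (of a)⁻¹) else of i)
    (fun i => if i = c then of c * (of a * of b * (of a)⁻¹)⁻¹ else of i)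
    (by simp +contextual) (by simp +contextual) (by
      simp [hρa, hρb, hρc, hρd, hab, hac, had, hbc, hbd, hcd, hba, hca,
        hda, hcb, hdb, hdc, mul_assoc])
  obtain ⟨J, hJ⟩ := key
    (fun i => if i = c then (of c)⁻¹ else of i)
    (fun i => if i = c then (of c)⁻¹ else of i)
    (by simp +contextual) (by simp +contextual) (by
      simp [hρa, hρb, hρc, hρd, hab, hac, had, hbc, hbd, hcd, hba, hca,
        hda, hcb, hdb, hdc, mul_assoc])
  obtain ⟨K, hK⟩ := key
    (fun i => if i = c then (of a * of b * (of a)⁻¹) * of c * (of a * of b * (of a)⁻¹)⁻¹ else of i)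
    (fun i => if i = c then (of a * of b * (of a)⁻¹)⁻¹ * of c * (of a * of b * (of a)⁻¹) else of i)
    (by simp +contextual) (by simp +contextual) (by
      simp [hρa, hρb, hρc, hρd, hab, hac, had, hbc, hbd, hcd, hba, hca,
        hda, hcb, hdb, hdc, mul_assoc])
  obtain ⟨I, hI⟩ := key
    (fun i => if i = a then of c * of a * (of c)⁻¹ else
      if i = b then of c * of b * (of c)⁻¹ else of i)
    (fun i => if i = a then (of c)⁻¹ * of a * of c else
      if i = b then (of c)⁻¹ * of b * of c else of i)
    (by simp +contextual) (by simp +contextual) (by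
      simp [hρa, hρb, hρc, hρd, hab, hac, had, hbc, hbd, hcd, hba, hca,
        hda, hcb, hdb, hdc, mul_assoc])
  obtain ⟨I', hI'⟩ := key
    (fun i => if i = a then (of a * of b * (of a)⁻¹) * of a * (of a * of b * (of a)⁻¹)⁻¹ else
      if i = b then (of a * of b * (of a)⁻¹) * of b * (of a * of b * (of a)⁻¹)⁻¹ else
      if i = c then (of a * of b * (of a)⁻¹) * of c * (of a * of b * (of a)⁻¹)⁻¹ else of i)
    (fun i => if i = a then (of a * of b * (of a)⁻¹)⁻¹ * of a * (of a * of b * (of a)⁻¹) else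
      if i = b then (of a * of b * (of a)⁻¹)⁻¹ * of b * (of a * of b * (of a)⁻¹) else
      if i = c then (of a * of b * (of a)⁻¹)⁻¹ * of c * (of a * of b * (of a)⁻¹) else of i)
    (by simp +contextual) (by simp +contextual) (by
      simp [hρa, hρb, hρc, hρd, hab, hac, had, hbc, hbd, hcd, hba, hca,
        hda, hcb, hdb, hdc, mul_assoc])
  obtain ⟨U, hU⟩ := key
    (fun i => if i = a then of a * (of c)⁻¹ else
      if i = b then of c * of b * (of c)⁻¹ else of i)
    (fun i => if i = a then of a * of c else
      if i = b then (of c)⁻¹ * of b * of c else of i)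
    (by simp +contextual) (by simp +contextual) (by
      simp [hρa, hρb, hρc, hρd, hab, hac, had, hbc, hbd, hcd, hba, hca,
        hda, hcb, hdb, hdc, mul_assoc])
  obtain ⟨U', hU'⟩ := key
    (fun i => if i = a then of a * (of a * of b * (of a)⁻¹)⁻¹ else
      if i = b then (of a * of b * (of a)⁻¹) * of b * (of a * of b * (of a)⁻¹)⁻¹ else of i)
    (fun i => if i = a then of a * (of a * of b * (of a)⁻¹) else
      if i = b then (of a * of b * (of a)⁻¹)⁻¹ * of b * (of a * of b * (of a)⁻¹) else of i)
    (by simp +contextual) (by simp +contextual) (by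
      simp [hρa, hρb, hρc, hρd, hab, hac, had, hbc, hbd, hcd, hba, hca,
        hda, hcb, hdb, hdc, mul_assoc])
  have hr : T * R * S = S * T :=
    ext4 (by simp +contextual [hT, hS, hR, hρ]) (by
      simp [hT, hS, hR, hρa, hρb, hρc, hρd, hab, hac, had, hbc, hbd, hcd, hba, hca,
        hda, hcb, hdb, hdc, mul_assoc])
  have hk : K * (R * (J * R)) = J :=
    ext4 (by simp +contextual [hR, hJ, hK, hρ]) (by
      simp [hR, hJ, hK, hρa, hρb, hρc, hρd, hab, hac, had, hbc, hbd, hcd, hba, hca,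
        hda, hcb, hdb, hdc, mul_assoc])
  have hi : R * I = I * I' * R :=
    ext4 (by simp +contextual [hR, hI, hI', hρ]) (by
      simp [hR, hI, hI', hρa, hρb, hρc, hρd, hab, hac, had, hbc, hbd, hcd, hba, hca,
        hda, hcb, hdb, hdc, mul_assoc])
  have hu : R * U = U' * U * R :=
    ext4 (by simp +contextual [hR, hU, hU', hρ]) (by
      simp [hR, hU, hU', hρa, hρb, hρc, hρd, hab, hac, had, hbc, hbd, hcd, hba, hca,
        hda, hcb, hdb, hdc, mul_assoc])
  have hx : I' = ⟨ρ, mem_centralizer_self ρ⟩ * U' * K :=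
    ext4 (by simp +contextual [hK, hI', hU', hρ]) (by
      simp [hK, hI', hU', hρa, hρb, hρc, hρd, hab, hac, had, hbc, hbd, hcd, hba, hca,
        hda, hcb, hdb, hdc, mul_assoc])
  exact abelianization_of_eq_one_of_relations hr hk hi hu hx

/-- for every `n ≥ 4` (written as `n = m + 4`; the free group has basis
`{a, b, c₁, …, c_{n-2}}` with `a = of 0`, `b = of 1`, `cᵢ = of (i+1)`), the Nielsen
automorphism `ρ : a ↦ ab, b ↦ b, cᵢ ↦ cᵢ` lies in the commutator subgroup of its
centralizer, i.e. its class in the abelianization of the centralizer is trivial. -/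
theorem nielsen_class_trivial_ge4
    (m : ℕ)
    (ρ : MulAut (FreeGroup (Fin (m + 4))))
    (hρa : ρ (FreeGroup.of 0) = FreeGroup.of 0 * FreeGroup.of 1)
    (hρ : ∀ i : Fin (m + 4), i ≠ 0 → ρ (FreeGroup.of i) = FreeGroup.of i) :
    Abelianization.of (⟨ρ, mem_centralizer_self ρ⟩ :
      Subgroup.centralizer {ρ}) = 1 := by
  have h2 : 2 % (m + 4) = 2 := Nat.mod_eq_of_lt (by omega)
  have h3 : 3 % (m + 4) = 3 := Nat.mod_eq_of_lt (by omega)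
  exact abelianization_of_nielsen (a := 0) (b := 1) (c := 2) (d := 3) (by simp)
    (by simp [Fin.ext_iff, h2]) (by simp [Fin.ext_iff, h3]) (by simp [Fin.ext_iff, h2])
    (by simp [Fin.ext_iff, h3]) (by simp [Fin.ext_iff, h2, h3]) ρ hρa hρ
end
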